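/- arXiv:2207.07541 — 2 statements merged into one kernel-verified Lean document; each statement's English description precedes it below -/
import Mathlib

section
/- Let Ω and Ω̃ be domains in ℝⁿ (n ≥ 2), let 1 < q < ∞, and let w be a weight with w^q ∈ A_q. Then a homeomorphism φ : Ω → Ω̃ generates a bounded composition operator φ* : L¹_∞(Ω̃) → L¹_q(Ω,w) (i.e., there is K < ∞ such that for every continuous f ∈ L¹_∞(Ω̃) the composition f∘φ is weakly differentiable on Ω with ‖f∘φ | L¹_q(Ω,w)‖ ≤ K‖f | L¹_∞(Ω̃)‖) if and only if φ belongs to the weighted Sobolev space L¹_q(Ω,w;Ω̃). -/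
open MeasureTheory Set Metric Filter ENNReal

noncomputable section

/-- Euclidean space `ℝⁿ`. -/
abbrev En (n : ℕ) : Type := EuclideanSpace ℝ (Fin n)

/-- A domain: an open connected set. -/
def IsDomainSet {n : ℕ} (Ω : Set (En n)) : Prop := IsOpen Ω ∧ IsConnected Ω

/-- A weight: a nonnegative locally integrable function. -/
def IsWeight (n : ℕ) (w : En n → ℝ) : Prop :=
  (∀ x, 0 ≤ w x) ∧ LocallyIntegrable w volume

/-- The Muckenhoupt `A_p` condition for the function `u` (to be applied to `u = w^p`):
`sup_B (|B|⁻¹ ∫_B u)^{1/p} (|B|⁻¹ ∫_B u^{-1/(p-1)})^{1/p'} < ∞`. -/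
def IsMuckenhoupt (n : ℕ) (p : ℝ) (u : En n → ℝ) : Prop :=
  ∃ C : ℝ≥0∞, C ≠ ⊤ ∧ ∀ (x : En n) (r : ℝ), 0 < r →
    ((volume (ball x r))⁻¹ * ∫⁻ y in ball x r, ENNReal.ofReal (u y)) ^ (1 / p) *
      ((volume (ball x r))⁻¹ *
        ∫⁻ y in ball x r, ENNReal.ofReal (u y ^ (-(1 / (p - 1))))) ^ (1 - 1 / p) ≤ C

/-- `g` is a weak gradient of `f` on `Ω` (both locally integrable on `Ω`). -/
def IsWeakGradOn {n : ℕ} (Ω : Set (En n)) (f : En n → ℝ) (g : En n → En n) : Prop :=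
  LocallyIntegrableOn f Ω volume ∧ LocallyIntegrableOn g Ω volume ∧
    ∀ ψ : En n → ℝ, ContDiff ℝ (⊤ : ℕ∞) ψ → HasCompactSupport ψ → tsupport ψ ⊆ Ω →
      ∀ i : Fin n,
        ∫ x in Ω, f x * fderiv ℝ ψ x (EuclideanSpace.single i 1) = -∫ x in Ω, g x i * ψ x

/-- The weighted Sobolev seminorm `‖f | L¹_p(Ω,w)‖`, computed from a weak gradient `g` of `f`. -/
def gradNormLp {n : ℕ} (Ω : Set (En n)) (w : En n → ℝ) (p : ℝ) (g : En n → En n) : ℝ≥0∞ :=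
  (∫⁻ x in Ω, ENNReal.ofReal (‖g x‖ * w x) ^ p) ^ (1 / p)

/-- Operator (Euclidean) norm of an `n × n` matrix. -/
def opNorm {n : ℕ} (M : Matrix (Fin n) (Fin n) ℝ) : ℝ :=
  ‖Matrix.toEuclideanCLM (𝕜 := ℝ) M‖

/-- `Dφ` is the matrix of weak partial derivatives of the mapping `φ` on `Ω`
(row `i` is the weak gradient of the `i`-th coordinate function of `φ`). -/
def IsWeakJacobiOn {n : ℕ} (Ω : Set (En n)) (φ : En n → En n)
    (Dφ : En n → Matrix (Fin n) (Fin n) ℝ) : Prop :=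
  ∀ i : Fin n, IsWeakGradOn Ω (fun x => φ x i)
    (fun x => (EuclideanSpace.equiv (Fin n) ℝ).symm (Dφ x i))

/-- `φ ∈ L¹_q(Ω,w;Ω')`: weakly differentiable with Jacobi matrix `Dφ` and
`∫_Ω |Dφ|^q w^q dx < ∞`. -/
def MapInL1q {n : ℕ} (Ω : Set (En n)) (w : En n → ℝ) (q : ℝ) (φ : En n → En n)
    (Dφ : En n → Matrix (Fin n) (Fin n) ℝ) : Prop :=
  IsWeakJacobiOn Ω φ Dφ ∧ (∫⁻ x in Ω, ENNReal.ofReal (opNorm (Dφ x) * w x) ^ q) ≠ ⊤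

/-- Finite distortion: `Dφ(x) = 0` a.e. on the zero set of the Jacobian. -/
def HasFiniteDistortionOn {n : ℕ} (Ω : Set (En n))
    (Dφ : En n → Matrix (Fin n) (Fin n) ℝ) : Prop :=
  ∀ᵐ x ∂(volume.restrict Ω), (Dφ x).det = 0 → Dφ x = 0

/-- Luzin N-property: images of null subsets of `Ω` are null. -/
def LuzinN {n : ℕ} (Ω : Set (En n)) (φ : En n → En n) : Prop :=
  ∀ E, E ⊆ Ω → volume E = 0 → volume (φ '' E) = 0

/-- `φ` is a homeomorphism of `Ω` onto `Ω'` with inverse `ψ`. -/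
def IsHomeoOn {n : ℕ} (Ω Ω' : Set (En n)) (φ ψ : En n → En n) : Prop :=
  ContinuousOn φ Ω ∧ ContinuousOn ψ Ω' ∧ MapsTo φ Ω Ω' ∧ MapsTo ψ Ω' Ω ∧
    (∀ x ∈ Ω, ψ (φ x) = x) ∧ (∀ y ∈ Ω', φ (ψ y) = y)

/-- The homeomorphism `φ : Ω → Ω'` generates a composition operator
`φ* : L¹_p(Ω',w') → L¹_q(Ω,w)` bounded by the constant `K`. -/
def CompOpBound {n : ℕ} (Ω Ω' : Set (En n)) (φ : En n → En n) (p : ℝ) (w' : En n → ℝ)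
    (q : ℝ) (w : En n → ℝ) (K : ℝ≥0∞) : Prop :=
  ∀ f gf, ContinuousOn f Ω' → IsWeakGradOn Ω' f gf → gradNormLp Ω' w' p gf ≠ ⊤ →
    ∃ g, IsWeakGradOn Ω (f ∘ φ) g ∧ gradNormLp Ω w q g ≤ K * gradNormLp Ω' w' p gf

/-- The homeomorphism `φ : Ω → Ω'` generates a bounded composition operator
`φ* : L¹_p(Ω',w') → L¹_q(Ω,w)`. -/
def BddCompOp {n : ℕ} (Ω Ω' : Set (En n)) (φ : En n → En n) (p : ℝ) (w' : En n → ℝ)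
    (q : ℝ) (w : En n → ℝ) : Prop :=
  ∃ K : ℝ≥0∞, K ≠ ⊤ ∧ CompOpBound Ω Ω' φ p w' q w K

theorem exists_bounded_density_of_L1_dual {α : Type*} [MeasurableSpace α] (μ : Measure α)
    [IsFiniteMeasure μ] (Λ : Lp ℝ 1 μ →L[ℝ] ℝ) (hΛ : ‖Λ‖ ≤ 1) :
    ∃ h : α → ℝ, AEStronglyMeasurable h μ ∧ (∀ᵐ x ∂μ, |h x| ≤ 1) ∧
      ∀ F : Lp ℝ 1 μ, Λ F = ∫ x, h x * F x ∂μ := by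
  let one : Lp ℝ 2 μ := (memLp_const (1 : ℝ)).toLp _
  let ℓ : Lp ℝ 2 μ →L[ℝ] ℝ :=
    Λ.comp ((ContinuousLinearMap.mul ℝ ℝ).holderL μ 2 2 1 one)
  let b : Lp ℝ 2 μ := (InnerProductSpace.toDual ℝ (Lp ℝ 2 μ)).symm ℓ
  have hbint : Integrable b μ := (Lp.memLp b).integrable (by norm_num)
  have hind : ∀ (c : ℝ) {s : Set α} (hs : MeasurableSet s),
      Λ (indicatorConstLp 1 hs (measure_ne_top μ s) c) = (∫ x in s, b x ∂μ) * c := by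
    intro c s hs
    have h1 : ((ContinuousLinearMap.mul ℝ ℝ).holderL μ 2 2 1 one)
        (indicatorConstLp 2 hs (measure_ne_top μ s) c) =
        indicatorConstLp 1 hs (measure_ne_top μ s) c := by
      apply Lp.ext
      have := (ContinuousLinearMap.mul ℝ ℝ).coeFn_holder (r := 1) one
        (indicatorConstLp 2 hs (measure_ne_top μ s) c)
      refine EventuallyEq.trans this ?_
      filter_upwards [(memLp_const (1 : ℝ)).coeFn_toLp (μ := μ) (p := 2),
        indicatorConstLp_coeFn (p := 2) (hs := hs) (hμs := measure_ne_top μ s) (c := c),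
        indicatorConstLp_coeFn (p := 1) (hs := hs) (hμs := measure_ne_top μ s) (c := c)]
        with x h1 h2 h3
      rw [h2, h3, show (one : α → ℝ) x = 1 from h1]
      simp
    have h2 : inner ℝ b (indicatorConstLp 2 hs (measure_ne_top μ s) c) =
        ℓ (indicatorConstLp 2 hs (measure_ne_top μ s) c) :=
      InnerProductSpace.toDual_symm_apply
    rw [← h1]
    change ℓ _ = _
    rw [← h2, real_inner_comm, L2.inner_indicatorConstLp_eq_inner_setIntegral]
    simp
  have hle : ∀ s, MeasurableSet s → |∫ x in s, b x ∂μ| ≤ μ.real s := by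
    intro s hs
    have h := hind 1 hs
    rw [mul_one] at h
    rw [← h, ← Real.norm_eq_abs]
    refine (Λ.le_opNorm _).trans ?_
    rw [norm_indicatorConstLp (by norm_num) (by norm_num)]
    simpa using mul_le_mul_of_nonneg_right hΛ (measureReal_nonneg (μ := μ) (s := s))
  have hb1 : ∀ᵐ x ∂μ, |b x| ≤ 1 := by
    have hA : (b : α → ℝ) ≤ᵐ[μ] fun _ => (1 : ℝ) := by
      refine ae_le_of_forall_setIntegral_le hbint (integrable_const _) fun s hs _ => ?_
      simpa using (le_abs_self _).trans (hle s hs)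
    have hB : (fun x => -b x) ≤ᵐ[μ] fun _ => (1 : ℝ) := by
      refine ae_le_of_forall_setIntegral_le hbint.neg (integrable_const _) fun s hs _ => ?_
      rw [integral_neg]
      simpa using (neg_le_abs _).trans (hle s hs)
    filter_upwards [hA, hB] with x h1 h2
    exact abs_le'.2 ⟨h1, h2⟩
  have hbtop : MemLp b ⊤ μ := memLp_top_of_bound (Lp.aestronglyMeasurable b) 1 hb1
  refine ⟨b, Lp.aestronglyMeasurable b, hb1, fun F => ?_⟩
  let P : Lp ℝ 1 μ →L[ℝ] ℝ := (ContinuousLinearMap.mul ℝ ℝ).lpPairing μ ⊤ 1 (hbtop.toLp _)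
  have hP : ∀ F : Lp ℝ 1 μ, P F = ∫ x, b x * F x ∂μ := by
    intro F
    refine ((ContinuousLinearMap.mul ℝ ℝ).lpPairing_eq_integral _ _).trans ?_
    refine integral_congr_ae ?_
    filter_upwards [hbtop.coeFn_toLp] with x hx
    simp [hx]
  rw [← hP]
  refine Lp.induction (by norm_num) (fun F => Λ F = P F) ?_ ?_ ?_ F
  · intro c s hs hμs
    rw [Lp.simpleFunc.coe_indicatorConst, hind, hP]
    rw [← integral_mul_const, ← integral_indicator hs]
    refine integral_congr_ae ?_
    filter_upwards [indicatorConstLp_coeFn (p := 1) (hs := hs) (hμs := hμs.ne) (c := c)] with x hx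
    rw [hx]
    by_cases hxs : x ∈ s <;> simp [hxs]
  · intro f g hf hg _ h1 h2
    rw [map_add, map_add, h1, h2]
  · exact isClosed_eq Λ.continuous P.continuous

theorem exists_bounded_density_of_le_integral_abs {α V : Type*} [MeasurableSpace α]
    (μ : Measure α) [SigmaFinite μ] [AddCommGroup V] [Module ℝ V]
    (e : V →ₗ[ℝ] (α → ℝ)) (he : ∀ v, Integrable (e v) μ) (T : V →ₗ[ℝ] ℝ)
    (hT : ∀ v, |T v| ≤ ∫ x, |e v x| ∂μ) :
    ∃ h : α → ℝ, AEStronglyMeasurable h μ ∧ (∀ᵐ x ∂μ, |h x| ≤ 1) ∧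
      ∀ v, T v = ∫ x, h x * e v x ∂μ := by
  obtain ⟨θ, hθ0, hθm, hθ1⟩ := exists_pos_lintegral_lt_of_sigmaFinite μ one_ne_zero
  let ν := μ.withDensity fun x => (θ x : ℝ≥0∞)
  have hfin : IsFiniteMeasure ν := isFiniteMeasure_withDensity (hθ1.trans one_lt_top).ne
  have hac : μ ≪ ν := withDensity_absolutelyContinuous' hθm.coe_nnreal_ennreal.aemeasurable
    (Eventually.of_forall fun x => by simpa using (hθ0 x).ne')
  have hpos : ∀ x, (θ x : ℝ) ≠ 0 := fun x => by exact_mod_cast (hθ0 x).ne'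
  have hint : ∀ v, Integrable (fun x => e v x / θ x) ν := by
    intro v
    rw [integrable_withDensity_iff_integrable_smul hθm]
    refine (he v).congr (Eventually.of_forall fun x => ?_)
    simp only [NNReal.smul_def, smul_eq_mul]
    rw [mul_div_cancel₀ _ (hpos x)]
  let E : V →ₗ[ℝ] Lp ℝ 1 ν :=
    { toFun := fun v => (hint v).toL1 _
      map_add' := fun v w => by
        rw [← Integrable.toL1_add]
        congr 1
        ext x
        simp [add_div]
      map_smul' := fun c v => by
        rw [RingHom.id_apply, ← Integrable.toL1_smul]
        congr 1
        ext x
        simp [mul_div_assoc] }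
  have hEc : ∀ v, (E v : α → ℝ) =ᵐ[ν] fun x => e v x / θ x := fun v => (hint v).coeFn_toL1
  have hEn : ∀ v, ‖E v‖ = ∫ x, |e v x| ∂μ := by
    intro v
    rw [L1.norm_eq_integral_norm]
    refine (integral_congr_ae ((hEc v).fun_comp norm)).trans ?_
    rw [integral_withDensity_eq_integral_smul hθm]
    refine integral_congr_ae (Eventually.of_forall fun x => ?_)
    simp only [NNReal.smul_def, smul_eq_mul, Function.comp]
    rw [Real.norm_eq_abs, abs_div, NNReal.abs_eq, mul_div_cancel₀ _ (hpos x)]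
  have hker : LinearMap.ker E ≤ LinearMap.ker T := by
    intro v hv
    rw [LinearMap.mem_ker] at hv ⊢
    have := hT v
    rw [← hEn, hv, norm_zero] at this
    exact abs_eq_zero.1 (le_antisymm this (abs_nonneg _))
  let T' : LinearMap.range E →ₗ[ℝ] ℝ :=
    ((LinearMap.ker E).liftQ T hker).comp E.quotKerEquivRange.symm.toLinearMap
  have hT' : ∀ v, T' ⟨E v, LinearMap.mem_range_self E v⟩ = T v := by
    intro v
    have : E.quotKerEquivRange.symm ⟨E v, LinearMap.mem_range_self E v⟩ =
        (LinearMap.ker E).mkQ v := LinearMap.quotKerEquivRange_symm_apply_image E v _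
    simp only [T', LinearMap.comp_apply, LinearEquiv.coe_coe, this]
    simp
  have hT'b : ∀ y, ‖T' y‖ ≤ 1 * ‖y‖ := by
    rintro ⟨y, v, rfl⟩
    rw [hT', one_mul, Real.norm_eq_abs]
    exact (hT v).trans_eq (hEn v).symm
  obtain ⟨Λ, hΛ, hΛn⟩ := exists_extension_norm_eq _ (T'.mkContinuous 1 hT'b)
  obtain ⟨h, hm, hb, hrep⟩ := exists_bounded_density_of_L1_dual ν Λ
    (hΛn.trans_le (LinearMap.mkContinuous_norm_le _ zero_le_one _))
  refine ⟨h, hm.mono_ac hac, hac.ae_le hb, fun v => ?_⟩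
  have h1 : Λ (E v) = T v := by
    rw [← hT' v]
    exact hΛ ⟨E v, LinearMap.mem_range_self E v⟩
  rw [← h1, hrep]
  have h2 : (fun x => h x * E v x) =ᵐ[ν] fun x => h x * (e v x / θ x) := by
    filter_upwards [hEc v] with x hx
    rw [hx]
  rw [integral_congr_ae h2, integral_withDensity_eq_integral_smul hθm]
  refine integral_congr_ae (Eventually.of_forall fun x => ?_)
  simp only [NNReal.smul_def, smul_eq_mul]
  have := hpos x
  field_simp

theorem LocallyIntegrableOn.integrable_restrict_mul {n : ℕ} {Ω : Set (En n)}
    {u ψ : En n → ℝ} (hu : LocallyIntegrableOn u Ω volume) (hψ : Continuous ψ)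
    (hc : HasCompactSupport ψ) (hs : tsupport ψ ⊆ Ω) :
    Integrable (fun x => u x * ψ x) (volume.restrict Ω) := by
  have h1 : IntegrableOn u (tsupport ψ) volume := hu.integrableOn_compact_subset hs hc
  have h2 : IntegrableOn (fun x => u x * ψ x) (tsupport ψ) volume :=
    h1.mul_continuousOn hψ.continuousOn hc
  have h3 : Integrable (fun x => u x * ψ x) volume :=
    (integrableOn_iff_integrable_of_support_subset
      ((Function.support_mul_subset_right u ψ).trans (subset_tsupport ψ))).1 h2
  exact h3.restrict

/-- Smooth functions with compact support in `Ω`, as a space of functions. -/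
def testFunctions {n : ℕ} (Ω : Set (En n)) : Submodule ℝ (En n → ℝ) where
  carrier := {ψ | ContDiff ℝ (⊤ : ℕ∞) ψ ∧ HasCompactSupport ψ ∧ tsupport ψ ⊆ Ω}
  add_mem' := fun {a b} ha hb => ⟨ha.1.add hb.1, ha.2.1.add hb.2.1,
    (tsupport_add a b).trans (union_subset ha.2.2 hb.2.2)⟩
  zero_mem' := ⟨contDiff_const, HasCompactSupport.zero, by simp [tsupport]⟩
  smul_mem' := fun c a ha => ⟨contDiff_const.smul ha.1, ha.2.1.smul_left (f := fun _ => c),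
    (tsupport_smul_subset_right (fun _ => c) a).trans ha.2.2⟩

theorem exists_weak_derivative_of_le_integral {n : ℕ} {Ω : Set (En n)} (hΩ : IsOpen Ω)
    {u H : En n → ℝ} (hu : LocallyIntegrableOn u Ω volume) (hH : LocallyIntegrableOn H Ω volume)
    (hH0 : ∀ x, 0 ≤ H x) (v : En n)
    (hb : ∀ ψ : En n → ℝ, ContDiff ℝ (⊤ : ℕ∞) ψ → HasCompactSupport ψ → tsupport ψ ⊆ Ω →
      |∫ x in Ω, u x * fderiv ℝ ψ x v| ≤ ∫ x in Ω, H x * |ψ x|) :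
    ∃ h : En n → ℝ, LocallyIntegrableOn h Ω volume ∧
      (∀ᵐ x ∂(volume.restrict Ω), |h x| ≤ H x) ∧
      ∀ ψ : En n → ℝ, ContDiff ℝ (⊤ : ℕ∞) ψ → HasCompactSupport ψ → tsupport ψ ⊆ Ω →
        ∫ x in Ω, u x * fderiv ℝ ψ x v = -∫ x in Ω, h x * ψ x := by
  have hint : ∀ ψ : testFunctions Ω,
      Integrable (fun x => u x * fderiv ℝ (ψ : En n → ℝ) x v) (volume.restrict Ω) := by
    rintro ⟨ψ, h1, h2, h3⟩
    exact LocallyIntegrableOn.integrable_restrict_mul hu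
      ((h1.continuous_fderiv (by simp)).clm_apply continuous_const)
      (h2.fderiv_apply ℝ v) ((tsupport_fderiv_apply_subset ℝ v).trans h3)
  let T : testFunctions Ω →ₗ[ℝ] ℝ :=
    { toFun := fun ψ => -∫ x in Ω, u x * fderiv ℝ (ψ : En n → ℝ) x v
      map_add' := fun a b => by
        rw [← neg_add, ← integral_add (hint a) (hint b)]
        congr 2
        ext x
        have ha := (a.2.1.differentiable (by simp)) x
        have hb := (b.2.1.differentiable (by simp)) x
        rw [Submodule.coe_add, fderiv_add ha hb]
        simp [mul_add]
      map_smul' := fun c a => by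
        rw [RingHom.id_apply, smul_neg, ← integral_smul]
        congr 2
        ext x
        have ha := (a.2.1.differentiable (by simp)) x
        rw [Submodule.coe_smul, fderiv_const_smul ha]
        simp
        ring }
  let e : testFunctions Ω →ₗ[ℝ] (En n → ℝ) :=
    { toFun := fun ψ x => H x * (ψ : En n → ℝ) x
      map_add' := fun a b => by
        ext x
        simp [mul_add]
      map_smul' := fun c a => by
        ext x
        simp
        ring }
  obtain ⟨b, hbm, hb1, hrep⟩ := exists_bounded_density_of_le_integral_abs (volume.restrict Ω) e
    (fun ψ => LocallyIntegrableOn.integrable_restrict_mul hH ψ.2.1.continuous ψ.2.2.1 ψ.2.2.2)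
    T (fun ψ => by
      simp only [T, e, LinearMap.coe_mk, AddHom.coe_mk, abs_neg, abs_mul, abs_of_nonneg (hH0 _)]
      exact hb ψ ψ.2.1 ψ.2.2.1 ψ.2.2.2)
  have hle : ∀ᵐ x ∂(volume.restrict Ω), |b x * H x| ≤ H x := by
    filter_upwards [hb1] with x hx
    rw [abs_mul, abs_of_nonneg (hH0 x)]
    exact mul_le_of_le_one_left (hH0 x) hx
  refine ⟨fun x => b x * H x, ?_, hle, fun ψ h1 h2 h3 => ?_⟩
  · refine (locallyIntegrableOn_iff hΩ.isLocallyClosed).2 fun k hk hkc => ?_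
    refine Integrable.mono (hH.integrableOn_compact_subset hk hkc)
      ((hbm.mul hH.aestronglyMeasurable).mono_set hk) ?_
    filter_upwards [ae_mono (Measure.restrict_mono hk le_rfl) hle] with x hx
    rwa [Real.norm_eq_abs, Real.norm_eq_abs, abs_of_nonneg (hH0 x)]
  · have := hrep ⟨ψ, h1, h2, h3⟩
    simp only [T, e, LinearMap.coe_mk, AddHom.coe_mk] at this
    rw [← neg_eq_iff_eq_neg, this]
    simp only [mul_assoc]

/-- Convolution with a normalized smooth bump function. -/
def mollify {n : ℕ} {V : Type*} [NormedAddCommGroup V] [NormedSpace ℝ V]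
    (ρ : ContDiffBump (0 : En n)) (u : En n → V) : En n → V :=
  convolution (ρ.normed volume) u (ContinuousLinearMap.lsmul ℝ ℝ) volume

theorem contDiff_mollify {n : ℕ} {V : Type*} [NormedAddCommGroup V] [NormedSpace ℝ V]
    [CompleteSpace V]
    (ρ : ContDiffBump (0 : En n)) {u : En n → V} (hu : LocallyIntegrable u volume) :
    ContDiff ℝ (⊤ : ℕ∞) (mollify ρ u) :=
  ρ.hasCompactSupport_normed.contDiff_convolution_left _ ρ.contDiff_normed hu

theorem mollify_coord {n m : ℕ} (ρ : ContDiffBump (0 : En n)) {u : En n → En m}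
    (hu : LocallyIntegrable u volume) (j : Fin m) (x : En n) :
    mollify ρ u x j = mollify ρ (fun y => u y j) x := by
  have h := ρ.hasCompactSupport_normed.convolutionExists_left
    (ContinuousLinearMap.lsmul ℝ ℝ) (ρ.continuous_normed (μ := volume)) hu x
  have := (EuclideanSpace.proj j : En m →L[ℝ] ℝ).integral_comp_comm h.integrable
  simpa [mollify, convolution_def] using this.symm

theorem fderiv_mollify_indicator {n : ℕ} {U K : Set (En n)} (hKU : K ⊆ U) (hK : IsCompact K)
    {u g : En n → ℝ} {v : En n} (hu : LocallyIntegrableOn u U volume)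
    (hw : ∀ ψ : En n → ℝ, ContDiff ℝ (⊤ : ℕ∞) ψ → HasCompactSupport ψ → tsupport ψ ⊆ U →
      ∫ x in U, u x * fderiv ℝ ψ x v = -∫ x in U, g x * ψ x)
    (ρ : ContDiffBump (0 : En n)) {x : En n} (hx : closedBall x ρ.rOut ⊆ K) :
    fderiv ℝ (mollify ρ (K.indicator u)) x v = mollify ρ (K.indicator g) x := by
  have hKm := hK.measurableSet
  have hui : LocallyIntegrable (K.indicator u) volume :=
    ((integrable_indicator_iff hKm).2 (hu.integrableOn_compact_subset hKU hK)).locallyIntegrable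
  have hd : Differentiable ℝ (ρ.normed volume) :=
    (ρ.contDiff_normed (n := 1)).differentiable (by simp)
  set ψ : En n → ℝ := fun y => ρ.normed volume (x - y) with hψ
  have hψc : ContDiff ℝ (⊤ : ℕ∞) ψ := ρ.contDiff_normed.comp (contDiff_const.sub contDiff_id)
  have hψd : ∀ y, fderiv ℝ ψ y v = -fderiv ℝ (ρ.normed volume) (x - y) v := by
    intro y
    have h1 : HasFDerivAt (fun y : En n => x - y) (-ContinuousLinearMap.id ℝ (En n)) y :=
      (hasFDerivAt_id y).const_sub x
    have h2 := (hd (x - y)).hasFDerivAt.comp y h1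
    have h3 : fderiv ℝ ψ y = _ := h2.fderiv
    rw [h3]
    simp
  have hψs : Function.support ψ ⊆ closedBall x ρ.rOut := by
    intro y hy
    have : x - y ∈ Function.support (ρ.normed volume) := hy
    rw [ρ.support_normed_eq, mem_ball_zero_iff] at this
    rw [mem_closedBall, dist_comm, dist_eq_norm]
    exact this.le
  have hψt : tsupport ψ ⊆ closedBall x ρ.rOut := closure_minimal hψs isClosed_closedBall
  have hψk : HasCompactSupport ψ :=
    HasCompactSupport.of_support_subset_isCompact (isCompact_closedBall x ρ.rOut) hψs
  have key := hw ψ hψc hψk (hψt.trans (hx.trans hKU))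
  have hzero : ∀ y, y ∉ K → ψ y = 0 := fun y hy =>
    Function.notMem_support.1 fun h => hy (hx (hψs h))
  have hzero' : ∀ y, y ∉ K → fderiv ℝ ψ y v = 0 := fun y hy =>
    Function.notMem_support.1 fun h =>
      hy (hx (hψt (tsupport_fderiv_apply_subset ℝ v (subset_tsupport _ h))))
  have e1 : ∫ y in U, u y * fderiv ℝ ψ y v = ∫ y, K.indicator u y * fderiv ℝ ψ y v := by
    rw [setIntegral_eq_integral_of_forall_compl_eq_zero
      fun y hy => by rw [hzero' y fun h => hy (hKU h), mul_zero]]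
    refine integral_congr_ae (Eventually.of_forall fun y => ?_)
    by_cases hy : y ∈ K <;> simp [hy, hzero']
  have e2 : ∫ y in U, g y * ψ y = ∫ y, K.indicator g y * ψ y := by
    rw [setIntegral_eq_integral_of_forall_compl_eq_zero
      fun y hy => by rw [hzero y fun h => hy (hKU h), mul_zero]]
    refine integral_congr_ae (Eventually.of_forall fun y => ?_)
    by_cases hy : y ∈ K <;> simp [hy, hzero]
  have hD := ρ.hasCompactSupport_normed.hasFDerivAt_convolution_left
    (ContinuousLinearMap.lsmul ℝ ℝ) (ρ.contDiff_normed (n := 1) (μ := volume)) hui x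
  have hE := (ρ.hasCompactSupport_normed (μ := volume)).fderiv (𝕜 := ℝ) |>.convolutionExists_left
    ((ContinuousLinearMap.lsmul ℝ ℝ : ℝ →L[ℝ] ℝ →L[ℝ] ℝ).precompL (En n))
    ((ρ.contDiff_normed (n := 1)).continuous_fderiv (by simp)) hui x
  have hD' : fderiv ℝ (mollify ρ (K.indicator u)) x = _ := hD.fderiv
  have hsw := hE.integrable_swap
  rw [hD', convolution_eq_swap, ContinuousLinearMap.integral_apply hsw, mollify,
    convolution_eq_swap]
  rw [e1, e2] at key
  have e3 : ∫ y, K.indicator u y * fderiv ℝ ψ y v =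
      -∫ y, fderiv ℝ (ρ.normed volume) (x - y) v * K.indicator u y := by
    rw [← integral_neg]
    refine integral_congr_ae (Eventually.of_forall fun y => ?_)
    simp only [hψd]
    ring
  rw [e3, neg_inj] at key
  have e4 : ∀ y, ψ y = ρ.normed volume (x - y) := fun _ => rfl
  simpa [ContinuousLinearMap.precompL_apply, e4, mul_comm] using key

theorem abs_mollify_le {n : ℕ} (ρ : ContDiffBump (0 : En n)) {g : En n → ℝ} {M : ℝ}
    (hg : ∀ᵐ x, |g x| ≤ M) (x : En n) : |mollify ρ g x| ≤ M := by
  have h1 : ∀ᵐ y, |g (x - y)| ≤ M :=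
    (quasiMeasurePreserving_sub_left volume x).ae hg
  rw [mollify, convolution_def, ← Real.norm_eq_abs]
  have h2 := norm_integral_le_of_norm_le (ρ.integrable_normed.mul_const M)
    (f := fun y => (ContinuousLinearMap.lsmul ℝ ℝ) (ρ.normed volume y) (g (x - y))) (by
      filter_upwards [h1] with y hy
      rw [ContinuousLinearMap.lsmul_apply, smul_eq_mul, norm_mul, Real.norm_eq_abs,
        Real.norm_eq_abs, abs_of_nonneg (ρ.nonneg_normed y)]
      exact mul_le_mul_of_nonneg_left hy (ρ.nonneg_normed y))
  rwa [integral_mul_const, ρ.integral_normed, one_mul] at h2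

theorem integral_abs_mollify_mul_le {n : ℕ} (ρ : ContDiffBump (0 : En n)) {a P : En n → ℝ}
    {η : ℝ} (ha : Integrable a volume) (hP : Continuous P)
    (hPc : HasCompactSupport P) (hP0 : ∀ x, 0 ≤ P x)
    (hPη : ∀ x y, dist x y < ρ.rOut → P x ≤ P y + η) :
    ∫ x, |mollify ρ a x| * P x ≤ ∫ x, |a x| * (P x + η) := by
  have hb : Integrable (fun y => |a y| * (P y + η)) volume := by
    have h1 : Integrable (fun y => |a y| * P y) volume := by
      obtain ⟨C, hC⟩ := hP.bounded_above_of_compact_support hPc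
      exact ha.abs.mul_bdd (c := C) hP.aestronglyMeasurable (Eventually.of_forall hC)
    simpa only [mul_add, Pi.add_apply] using! h1.add (ha.abs.mul_const η)
  have hr := ρ.integrable_normed (μ := (volume : Measure (En n)))
  have hpt : ∀ x, |mollify ρ a x| * P x ≤ mollify ρ (fun y => |a y| * (P y + η)) x := by
    intro x
    have hE := ρ.hasCompactSupport_normed.convolutionExists_left
      (ContinuousLinearMap.lsmul ℝ ℝ) (ρ.continuous_normed (μ := volume)) hb.locallyIntegrable x
    have hE' := ρ.hasCompactSupport_normed.convolutionExists_left
      (ContinuousLinearMap.lsmul ℝ ℝ) (ρ.continuous_normed (μ := volume)) ha.locallyIntegrable x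
    simp only [mollify, convolution_def]
    refine (mul_le_mul_of_nonneg_right (abs_integral_le_integral_abs (f := fun t =>
      (ContinuousLinearMap.lsmul ℝ ℝ) (ρ.normed volume t) (a (x - t)))) (hP0 x)).trans ?_
    rw [← integral_mul_const]
    refine integral_mono (hE'.integrable.abs.mul_const _) hE.integrable fun t => ?_
    simp only [ContinuousLinearMap.lsmul_apply, smul_eq_mul, abs_mul,
      abs_of_nonneg (ρ.nonneg_normed t), mul_assoc]
    by_cases ht : t ∈ ball (0 : En n) ρ.rOut
    · refine mul_le_mul_of_nonneg_left (mul_le_mul_of_nonneg_left ?_ (abs_nonneg _))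
        (ρ.nonneg_normed t)
      refine hPη x (x - t) ?_
      rw [dist_eq_norm]
      simpa using ht
    · rw [← ρ.support_normed_eq (μ := volume), Function.notMem_support] at ht
      simp [ht]
  have hint : Integrable (mollify ρ (fun y => |a y| * (P y + η))) volume :=
    hr.integrable_convolution _ hb
  calc ∫ x, |mollify ρ a x| * P x ≤ ∫ x, mollify ρ (fun y => |a y| * (P y + η)) x := by
        refine integral_mono_of_nonneg (Eventually.of_forall fun x =>
          mul_nonneg (abs_nonneg _) (hP0 x)) hint (Eventually.of_forall hpt)
    _ = ∫ x, |a x| * (P x + η) := by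
        have := integral_convolution (ContinuousLinearMap.lsmul ℝ ℝ) hr hb
        rw [ρ.integral_normed] at this
        simpa [mollify] using this

theorem le_of_forall_pos_le_add_mul {A B C : ℝ} (h : ∀ η, 0 < η → A ≤ B + η * C) : A ≤ B := by
  have h1 : Tendsto (fun η : ℝ => B + η * C) (nhdsWithin 0 (Ioi 0)) (nhds (B + 0 * C)) :=
    ((continuous_const.add (continuous_id.mul continuous_const)).tendsto 0).mono_left
      nhdsWithin_le_nhds
  rw [zero_mul, add_zero] at h1
  exact ge_of_tendsto h1 (eventually_mem_nhdsWithin.mono h)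

theorem exists_bump_rOut_lt {n : ℕ} {δ : ℝ} (hδ : 0 < δ) :
    ∃ ρ : ContDiffBump (0 : En n), ρ.rOut < δ :=
  ⟨⟨δ / 4, δ / 2, by linarith, by linarith⟩, by simp only; linarith⟩

/-- Mollifications of a function which is continuous near a compact set converge uniformly on
this compact set. -/
theorem exists_dist_mollify_indicator_le {n : ℕ} {V : Type*} [NormedAddCommGroup V]
    [NormedSpace ℝ V] [CompleteSpace V] [SecondCountableTopology V] [MeasurableSpace V]
    [BorelSpace V] {L K : Set (En n)} (hK : IsCompact K) {δ : ℝ} (hδ : 0 < δ)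
    (hL : cthickening δ L ⊆ K) {u : En n → V} (hu : ContinuousOn u K) {η : ℝ} (hη : 0 < η) :
    ∃ δ' > 0, ∀ ρ : ContDiffBump (0 : En n), ρ.rOut < δ' → ∀ x ∈ L,
      dist (mollify ρ (K.indicator u) x) (u x) ≤ η := by
  have huc := hK.uniformContinuousOn_of_continuous hu
  rw [Metric.uniformContinuousOn_iff] at huc
  obtain ⟨δ₂, hδ₂, h₂⟩ := huc η hη
  refine ⟨min δ δ₂, lt_min hδ hδ₂, fun ρ hρ x hx => ?_⟩
  have hxK : ∀ y ∈ ball x ρ.rOut, y ∈ K := fun y hy =>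
    hL (closedBall_subset_cthickening hx δ
      ((mem_ball.1 hy).le.trans (hρ.le.trans (min_le_left _ _))))
  have hxx := hxK x (mem_ball_self ρ.rOut_pos)
  have hm : AEStronglyMeasurable (K.indicator u) volume :=
    (aestronglyMeasurable_indicator_iff hK.measurableSet).2
      (hu.aestronglyMeasurable hK.measurableSet)
  have := ρ.dist_normed_convolution_le (μ := volume) (x₀ := x) (ε := η) hm (fun y hy => by
    rw [indicator_of_mem (hxK y hy), indicator_of_mem hxx]
    exact (h₂ y (hxK y hy) x hxx ((mem_ball.1 hy).trans (hρ.trans_le (min_le_right _ _)))).le)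
  rwa [indicator_of_mem hxx] at this

theorem abs_clm_apply_le_mul_sum {n : ℕ} (ℓ : En n →L[ℝ] ℝ) {M : ℝ}
    (hℓ : ∀ j, |ℓ (EuclideanSpace.single j 1)| ≤ M) (y : En n) :
    |ℓ y| ≤ M * ∑ j, |y j| := by
  have hy : y = ∑ j, y j • (EuclideanSpace.single j 1 : En n) := by
    have := (EuclideanSpace.basisFun (Fin n) ℝ).sum_repr y
    simpa using this.symm
  calc |ℓ y| = |∑ j, y j * ℓ (EuclideanSpace.single j 1)| := by
        conv_lhs => rw [hy]
        simp [map_sum]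
    _ ≤ ∑ j, |y j * ℓ (EuclideanSpace.single j 1)| := Finset.abs_sum_le_sum_abs _ _
    _ ≤ ∑ j, M * |y j| := by
        refine Finset.sum_le_sum fun j _ => ?_
        rw [abs_mul, mul_comm M]
        exact mul_le_mul_of_nonneg_left (hℓ j) (abs_nonneg _)
    _ = M * ∑ j, |y j| := (Finset.mul_sum _ _ _).symm

theorem integral_mul_fderiv_eq_neg_of_contDiff {n : ℕ} {G ψ : En n → ℝ}
    (hG : ContDiff ℝ (⊤ : ℕ∞) G) (hψ : ContDiff ℝ (⊤ : ℕ∞) ψ) (hψc : HasCompactSupport ψ)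
    (v : En n) : ∫ x, G x * fderiv ℝ ψ x v = -∫ x, fderiv ℝ G x v * ψ x := by
  have hG' : Continuous fun x => fderiv ℝ G x v :=
    (hG.continuous_fderiv (by simp)).clm_apply continuous_const
  have hψ' : Continuous fun x => fderiv ℝ ψ x v :=
    (hψ.continuous_fderiv (by simp)).clm_apply continuous_const
  refine integral_mul_fderiv_eq_neg_fderiv_mul_of_integrable (𝕜 := ℝ) ?_ ?_ ?_
    (fun x _ => (hG.differentiable (by simp)) x) (fun x _ => hψ.differentiable (by simp) x)
  · exact (hG'.mul hψ.continuous).integrable_of_hasCompactSupport hψc.mul_left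
  · exact (hG.continuous.mul hψ').integrable_of_hasCompactSupport (hψc.fderiv_apply ℝ v).mul_left
  · exact (hG.continuous.mul hψ.continuous).integrable_of_hasCompactSupport hψc.mul_left

theorem abs_integral_sub_le {n : ℕ} {G G' θ : En n → ℝ} {η : ℝ}
    (hG : Integrable (fun x => G x * θ x)) (hG' : Integrable (fun x => G' x * θ x))
    (hθ : Continuous θ) (hθc : HasCompactSupport θ)
    (h : ∀ x ∈ tsupport θ, |G x - G' x| ≤ η) :
    |∫ x, G x * θ x| ≤ |∫ x, G' x * θ x| + η * ∫ x, |θ x| := by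
  have hθi := (hθ.integrable_of_hasCompactSupport (μ := volume) hθc).abs
  have h1 : |(∫ x, G x * θ x) - ∫ x, G' x * θ x| ≤ η * ∫ x, |θ x| := by
    rw [← integral_sub hG hG', ← integral_const_mul, ← Real.norm_eq_abs]
    refine norm_integral_le_of_norm_le (hθi.const_mul η) (Eventually.of_forall fun x => ?_)
    rw [← sub_mul, norm_mul, Real.norm_eq_abs, Real.norm_eq_abs]
    by_cases hx : x ∈ tsupport θ
    · exact mul_le_mul_of_nonneg_right (h x hx) (abs_nonneg _)
    · simp [image_eq_zero_of_notMem_tsupport hx]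
  have := abs_sub_abs_le_abs_sub (∫ x, G x * θ x) (∫ x, G' x * θ x)
  linarith

theorem setIntegral_mul_eq_of_tsupport_subset {n : ℕ} {Ω : Set (En n)} (u : En n → ℝ)
    {θ : En n → ℝ} (hs : tsupport θ ⊆ Ω) : ∫ x in Ω, u x * θ x = ∫ x, u x * θ x :=
  setIntegral_eq_integral_of_forall_compl_eq_zero fun x hx => by
    rw [image_eq_zero_of_notMem_tsupport fun h => hx (hs h), mul_zero]

/-- Composition of a smooth function with a continuous weakly differentiable mapping. -/
theorem abs_integral_smooth_comp_le {n : ℕ} {Ω : Set (En n)} (hΩ : IsOpen Ω)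
    {φ : En n → En n} (hφ : ContinuousOn φ Ω) {v : En n} {a : Fin n → En n → ℝ}
    (ha : ∀ j, LocallyIntegrableOn (a j) Ω volume)
    (hw : ∀ j, ∀ ψ : En n → ℝ, ContDiff ℝ (⊤ : ℕ∞) ψ → HasCompactSupport ψ → tsupport ψ ⊆ Ω →
      ∫ x in Ω, φ x j * fderiv ℝ ψ x v = -∫ x in Ω, a j x * ψ x)
    {F : En n → ℝ} (hF : ContDiff ℝ (⊤ : ℕ∞) F) {ψ : En n → ℝ} (hψ : ContDiff ℝ (⊤ : ℕ∞) ψ)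
    (hψc : HasCompactSupport ψ) (hψs : tsupport ψ ⊆ Ω) {W : Set (En n)} (hW : IsOpen W)
    (hφW : φ '' tsupport ψ ⊆ W) {M : ℝ} (hM0 : 0 ≤ M)
    (hM : ∀ y ∈ W, ∀ j, |fderiv ℝ F y (EuclideanSpace.single j 1)| ≤ M) :
    |∫ x in Ω, F (φ x) * fderiv ℝ ψ x v| ≤ ∫ x in Ω, (M * ∑ j, |a j x|) * |ψ x| := by
  set θ : En n → ℝ := fun x => fderiv ℝ ψ x v with hθ
  have hθk : Continuous θ := (hψ.continuous_fderiv (by simp)).clm_apply continuous_const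
  have hθc : HasCompactSupport θ := hψc.fderiv_apply ℝ v
  have hθs : tsupport θ ⊆ tsupport ψ := tsupport_fderiv_apply_subset ℝ v
  have habs : tsupport (fun x => |ψ x|) ⊆ tsupport ψ :=
    closure_mono fun x hx => by simpa using hx
  have habsc : HasCompactSupport (fun x => |ψ x|) := hψc.abs
  rw [setIntegral_mul_eq_of_tsupport_subset _ (hθs.trans hψs),
    setIntegral_mul_eq_of_tsupport_subset (fun x => M * ∑ j, |a j x|) (habs.trans hψs)]
  obtain ⟨K, hK, hψK, hKΩ⟩ := exists_compact_between hψc hΩ hψs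
  obtain ⟨δ, hδ, hδK⟩ := IsCompact.exists_cthickening_subset_open hψc isOpen_interior hψK
  have hδK' : cthickening δ (tsupport ψ) ⊆ K := hδK.trans interior_subset
  have hψK' : tsupport ψ ⊆ K := hψK.trans interior_subset
  have hai : ∀ j, Integrable (K.indicator (a j)) volume := fun j =>
    (integrable_indicator_iff hK.measurableSet).2 ((ha j).integrableOn_compact_subset hKΩ hK)
  have hφK : ContinuousOn φ K := hφ.mono hKΩ
  have hφi : LocallyIntegrable (K.indicator φ) volume :=
    ((integrable_indicator_iff hK.measurableSet).2
      (hφK.integrableOn_compact hK)).locallyIntegrable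
  have hLc : IsCompact (φ '' tsupport ψ) := hψc.image_of_continuousOn (hφ.mono hψs)
  obtain ⟨δ₁, hδ₁, hδ₁W⟩ := hLc.exists_cthickening_subset_open hW hφW
  have hFu := (hLc.cthickening (r := δ₁)).uniformContinuousOn_of_continuous
    hF.continuous.continuousOn
  rw [Metric.uniformContinuousOn_iff] at hFu
  refine le_of_forall_pos_le_add_mul
    (C := (∫ x, |θ x|) + M * ∑ j, ∫ x, |K.indicator (a j) x|) fun η hη => ?_
  obtain ⟨δ₂, hδ₂, hF₂⟩ := hFu η hη
  have hη' : 0 < min δ₁ (δ₂ / 2) := lt_min hδ₁ (by linarith)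
  obtain ⟨δ₃, hδ₃, hφ₃⟩ := exists_dist_mollify_indicator_le hK hδ hδK' hφK hη'
  have hψu := habsc.uniformContinuous_of_continuous hψ.continuous.abs
  rw [Metric.uniformContinuous_iff] at hψu
  obtain ⟨δ₄, hδ₄, hψ₄⟩ := hψu η hη
  obtain ⟨ρ, hρ⟩ := exists_bump_rOut_lt (n := n) (lt_min hδ (lt_min hδ₃ hδ₄))
  have hρ1 : ρ.rOut < δ := hρ.trans_le (min_le_left _ _)
  have hρ3 : ρ.rOut < δ₃ := hρ.trans_le ((min_le_right _ _).trans (min_le_left _ _))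
  have hρ4 : ρ.rOut < δ₄ := hρ.trans_le ((min_le_right _ _).trans (min_le_right _ _))
  set Φ := mollify ρ (K.indicator φ) with hΦ
  have hΦc : ContDiff ℝ (⊤ : ℕ∞) Φ := contDiff_mollify ρ hφi
  have hclose : ∀ x ∈ tsupport ψ, dist (Φ x) (φ x) ≤ min δ₁ (δ₂ / 2) := hφ₃ ρ hρ3
  have hΦL : ∀ x ∈ tsupport ψ, Φ x ∈ cthickening δ₁ (φ '' tsupport ψ) := fun x hx =>
    closedBall_subset_cthickening (mem_image_of_mem φ hx) δ₁
      ((hclose x hx).trans (min_le_left _ _))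
  have hFΦ : ∀ x ∈ tsupport ψ, |F (φ x) - F (Φ x)| ≤ η := by
    intro x hx
    refine (hF₂ _ (self_subset_cthickening _ (mem_image_of_mem φ hx)) _ (hΦL x hx) ?_).le
    rw [dist_comm]
    have := (hclose x hx).trans (min_le_right _ _)
    linarith
  have hG : ContDiff ℝ (⊤ : ℕ∞) (fun x => F (Φ x)) := hF.comp hΦc
  have hFφi : Integrable (fun x => F (φ x) * θ x) := by
    have h1 : ContinuousOn (fun x => F (φ x) * θ x) (tsupport ψ) :=
      (hF.continuous.comp_continuousOn (hφ.mono hψs)).mul hθk.continuousOn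
    refine (integrableOn_iff_integrable_of_support_subset ?_).1 (h1.integrableOn_compact hψc)
    exact (Function.support_mul_subset_right (fun x => F (φ x)) θ).trans
      ((subset_tsupport θ).trans hθs)
  have hstep := abs_integral_sub_le hFφi
    ((hG.continuous.mul hθk).integrable_of_hasCompactSupport hθc.mul_left) hθk hθc
    (fun x hx => hFΦ x (hθs hx))
  refine hstep.trans ?_
  have hbd : |∫ x, F (Φ x) * θ x| ≤
      M * ∑ j, ∫ x, |mollify ρ (K.indicator (a j)) x| * |ψ x| := by
    rw [hθ, integral_mul_fderiv_eq_neg_of_contDiff hG hψ hψc v, abs_neg]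
    have hmi : ∀ j, Integrable (fun x => |mollify ρ (K.indicator (a j)) x| * |ψ x|) := fun j =>
      ((contDiff_mollify ρ (hai j).locallyIntegrable).continuous.abs.mul
        hψ.continuous.abs).integrable_of_hasCompactSupport habsc.mul_left
    rw [← integral_finsetSum _ fun j _ => hmi j, ← integral_const_mul, ← Real.norm_eq_abs]
    refine norm_integral_le_of_norm_le ((integrable_finsetSum _ fun j _ => hmi j).const_mul M)
      (Eventually.of_forall fun x => ?_)
    rw [norm_mul, Real.norm_eq_abs, Real.norm_eq_abs, ← Finset.sum_mul, ← mul_assoc]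
    by_cases hx : x ∈ tsupport ψ
    · refine mul_le_mul_of_nonneg_right ?_ (abs_nonneg _)
      have hdΦ : DifferentiableAt ℝ Φ x := hΦc.differentiable (by simp) x
      have hdF : DifferentiableAt ℝ F (Φ x) := hF.differentiable (by simp) _
      have hch : fderiv ℝ (fun x => F (Φ x)) x v = fderiv ℝ F (Φ x) (fderiv ℝ Φ x v) := by
        have := fderiv_comp x hdF hdΦ
        rw [Function.comp_def] at this
        rw [this]
        rfl
      rw [hch]
      refine (abs_clm_apply_le_mul_sum _ (hM _ (hδ₁W (hΦL x hx))) _).trans_eq ?_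
      congr 1
      refine Finset.sum_congr rfl fun j _ => ?_
      congr 1
      have hball : closedBall x ρ.rOut ⊆ K :=
        (closedBall_subset_closedBall hρ1.le).trans
          ((closedBall_subset_cthickening hx δ).trans hδK')
      have hcont : ContinuousOn (fun y => φ y j) Ω :=
        (EuclideanSpace.proj (𝕜 := ℝ) j).continuous.comp_continuousOn hφ
      have hm := fderiv_mollify_indicator hKΩ hK
        (hcont.locallyIntegrableOn hΩ.measurableSet) (hw j) ρ hball
      rw [← hm]
      have hfun : (fun y => Φ y j) = mollify ρ (K.indicator fun y => φ y j) := by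
        ext y
        rw [hΦ, mollify_coord ρ hφi]
        congr 1
        ext z
        by_cases hz : z ∈ K <;> simp [hz]
      rw [← hfun]
      have h5 := ((EuclideanSpace.proj j : En n →L[ℝ] ℝ).hasFDerivAt.comp x hdΦ.hasFDerivAt).fderiv
      have h6 : fderiv ℝ (fun y => Φ y j) x = _ := h5
      rw [h6]
      rfl
    · simp [image_eq_zero_of_notMem_tsupport hx]
  have hL1 : ∀ j, ∫ x, |mollify ρ (K.indicator (a j)) x| * |ψ x| ≤
      (∫ x, |a j x| * |ψ x|) + η * ∫ x, |K.indicator (a j) x| := by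
    intro j
    refine (integral_abs_mollify_mul_le ρ (η := η) (hai j) hψ.continuous.abs habsc
      (fun x => abs_nonneg _) fun x y hxy => ?_).trans_eq ?_
    · have := hψ₄ (hxy.trans hρ4)
      rw [Real.dist_eq] at this
      linarith [le_abs_self (|ψ x| - |ψ y|)]
    · have e1 : ∀ x, |K.indicator (a j) x| * |ψ x| = |a j x| * |ψ x| := by
        intro x
        by_cases hx : x ∈ K
        · simp [hx]
        · simp [image_eq_zero_of_notMem_tsupport fun h => hx (hψK' h)]
      have e2 : Integrable (fun x => |K.indicator (a j) x| * |ψ x|) := by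
        obtain ⟨C, hC⟩ := hψ.continuous.abs.bounded_above_of_compact_support habsc
        exact (hai j).abs.mul_bdd (c := C) hψ.continuous.abs.aestronglyMeasurable
          (Eventually.of_forall hC)
      simp only [mul_add]
      rw [integral_add e2 ((hai j).abs.mul_const η), integral_mul_const, mul_comm η]
      simp only [e1]
  have hsum : ∫ x, (M * ∑ j, |a j x|) * |ψ x| = M * ∑ j, ∫ x, |a j x| * |ψ x| := by
    rw [← integral_finsetSum, ← integral_const_mul]
    · simp only [Finset.sum_mul, mul_assoc]
    · intro j _
      have h1 : IntegrableOn (fun x => |a j x| * |ψ x|) K volume :=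
        IntegrableOn.mul_continuousOn ((ha j).integrableOn_compact_subset hKΩ hK).abs
          hψ.continuous.abs.continuousOn hK
      refine (integrableOn_iff_integrable_of_support_subset ?_).1 h1
      exact (Function.support_mul_subset_right _ _).trans
        ((subset_tsupport _).trans (habs.trans hψK'))
  rw [hsum]
  have h7 := mul_le_mul_of_nonneg_left (Finset.sum_le_sum fun j (_ : j ∈ Finset.univ) => hL1 j) hM0
  rw [Finset.sum_add_distrib, ← Finset.mul_sum] at h7
  linarith

/-- Composition of a function with bounded weak gradient with a continuous weakly differentiable
mapping. -/
theorem abs_integral_comp_le {n : ℕ} {Ω Ω' : Set (En n)} (hΩ : IsOpen Ω) (hΩ' : IsOpen Ω')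
    {φ : En n → En n} (hφ : ContinuousOn φ Ω) (hφm : MapsTo φ Ω Ω') {v : En n}
    {a : Fin n → En n → ℝ} (ha : ∀ j, LocallyIntegrableOn (a j) Ω volume)
    (hw : ∀ j, ∀ ψ : En n → ℝ, ContDiff ℝ (⊤ : ℕ∞) ψ → HasCompactSupport ψ → tsupport ψ ⊆ Ω →
      ∫ x in Ω, φ x j * fderiv ℝ ψ x v = -∫ x in Ω, a j x * ψ x)
    {f : En n → ℝ} {gf : En n → En n} (hf : ContinuousOn f Ω') (hgf : IsWeakGradOn Ω' f gf)
    {M : ℝ} (hM0 : 0 ≤ M) (hM : ∀ᵐ y ∂(volume.restrict Ω'), ‖gf y‖ ≤ M)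
    {ψ : En n → ℝ} (hψ : ContDiff ℝ (⊤ : ℕ∞) ψ) (hψc : HasCompactSupport ψ)
    (hψs : tsupport ψ ⊆ Ω) :
    |∫ x in Ω, f (φ x) * fderiv ℝ ψ x v| ≤ ∫ x in Ω, (M * ∑ j, |a j x|) * |ψ x| := by
  set θ : En n → ℝ := fun x => fderiv ℝ ψ x v with hθ
  have hθk : Continuous θ := (hψ.continuous_fderiv (by simp)).clm_apply continuous_const
  have hθc : HasCompactSupport θ := hψc.fderiv_apply ℝ v
  have hθs : tsupport θ ⊆ tsupport ψ := tsupport_fderiv_apply_subset ℝ v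
  have hLc : IsCompact (φ '' tsupport ψ) := hψc.image_of_continuousOn (hφ.mono hψs)
  have hLΩ : φ '' tsupport ψ ⊆ Ω' := (hφm.mono_left hψs).image_subset
  obtain ⟨K, hK, hLK, hKΩ⟩ := exists_compact_between hLc hΩ' hLΩ
  obtain ⟨δ, hδ, hδK⟩ := hLc.exists_cthickening_subset_open isOpen_interior hLK
  have hδK' : cthickening δ (φ '' tsupport ψ) ⊆ K := hδK.trans interior_subset
  have hfK : ContinuousOn f K := hf.mono hKΩ
  have hfi : LocallyIntegrable (K.indicator f) volume :=
    ((integrable_indicator_iff hK.measurableSet).2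
      (hfK.integrableOn_compact hK)).locallyIntegrable
  refine le_of_forall_pos_le_add_mul (C := ∫ x, |θ x|) fun η hη => ?_
  obtain ⟨δ₁, hδ₁, hf₁⟩ := exists_dist_mollify_indicator_le hK hδ hδK' hfK hη
  obtain ⟨ρ, hρ⟩ := exists_bump_rOut_lt (n := n) (lt_min (half_pos hδ) hδ₁)
  have hρ1 : ρ.rOut < δ / 2 := hρ.trans_le (min_le_left _ _)
  have hρ2 : ρ.rOut < δ₁ := hρ.trans_le (min_le_right _ _)
  set F := mollify ρ (K.indicator f) with hF
  have hFc : ContDiff ℝ (⊤ : ℕ∞) F := contDiff_mollify ρ hfi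
  have hFd : ∀ y ∈ thickening (δ / 2) (φ '' tsupport ψ), ∀ j,
      |fderiv ℝ F y (EuclideanSpace.single j 1)| ≤ M := by
    intro y hy j
    obtain ⟨z, hz, hyz⟩ := mem_thickening_iff.1 hy
    have hball : closedBall y ρ.rOut ⊆ K := by
      refine (closedBall_subset_closedBall' ?_).trans
        ((closedBall_subset_cthickening hz δ).trans hδK')
      linarith
    rw [hF, fderiv_mollify_indicator (g := fun y => gf y j) hKΩ hK hgf.1
      (fun ψ h1 h2 h3 => hgf.2.2 ψ h1 h2 h3 j) ρ hball]
    refine abs_mollify_le ρ ?_ y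
    filter_upwards [(ae_restrict_iff' hΩ'.measurableSet).1 hM] with x hx
    by_cases hxK : x ∈ K
    · rw [indicator_of_mem hxK]
      exact (PiLp.norm_apply_le (gf x) j).trans (hx (hKΩ hxK))
    · rwa [indicator_of_notMem hxK, abs_zero]
  have hsmooth := abs_integral_smooth_comp_le hΩ hφ ha hw hFc hψ hψc hψs isOpen_thickening
    (self_subset_thickening (half_pos hδ) _) hM0 hFd
  have hint : ∀ G : En n → ℝ, ContinuousOn G Ω' → Integrable fun x => G (φ x) * θ x := by
    intro G hG
    have h1 : ContinuousOn (fun x => G (φ x) * θ x) (tsupport ψ) :=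
      (hG.comp (hφ.mono hψs) (hφm.mono_left hψs)).mul hθk.continuousOn
    refine (integrableOn_iff_integrable_of_support_subset ?_).1 (h1.integrableOn_compact hψc)
    exact (Function.support_mul_subset_right (fun x => G (φ x)) θ).trans
      ((subset_tsupport θ).trans hθs)
  have hstep := abs_integral_sub_le (hint f hf) (hint F hFc.continuous.continuousOn) hθk hθc
    (η := η) fun x hx => by
      rw [abs_sub_comm]
      exact hf₁ ρ hρ2 _ (mem_image_of_mem φ (hθs hx))
  rw [setIntegral_mul_eq_of_tsupport_subset _ (hθs.trans hψs)] at hsmooth ⊢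
  linarith

theorem abs_entry_le_opNorm {n : ℕ} (A : Matrix (Fin n) (Fin n) ℝ) (i j : Fin n) :
    |A i j| ≤ opNorm A := by
  have h1 : (Matrix.toEuclideanCLM (𝕜 := ℝ) A (EuclideanSpace.single j 1)) i = A i j := by
    simp [Matrix.ofLp_toEuclideanCLM]
  rw [← h1, ← Real.norm_eq_abs]
  refine (PiLp.norm_apply_le _ i).trans ((ContinuousLinearMap.le_opNorm _ _).trans ?_)
  simp [opNorm]

theorem norm_le_sum_abs {n : ℕ} (y : En n) : ‖y‖ ≤ ∑ j, |y j| := by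
  have hy : y = ∑ j, y j • (EuclideanSpace.single j 1 : En n) := by
    have := (EuclideanSpace.basisFun (Fin n) ℝ).sum_repr y
    simpa using this.symm
  conv_lhs => rw [hy]
  refine (norm_sum_le _ _).trans_eq ?_
  simp [norm_smul]

theorem opNorm_le_sum_norm_row {n : ℕ} (A : Matrix (Fin n) (Fin n) ℝ) :
    opNorm A ≤ ∑ i, ‖(EuclideanSpace.equiv (Fin n) ℝ).symm (A i)‖ := by
  refine ContinuousLinearMap.opNorm_le_bound _
    (Finset.sum_nonneg fun i _ => norm_nonneg _) fun x => ?_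
  refine (norm_le_sum_abs _).trans ?_
  rw [Finset.sum_mul]
  refine Finset.sum_le_sum fun i _ => ?_
  have h1 : (Matrix.toEuclideanCLM (𝕜 := ℝ) A x) i =
      inner ℝ ((EuclideanSpace.equiv (Fin n) ℝ).symm (A i)) x := by
    simp [Matrix.ofLp_toEuclideanCLM, Matrix.mulVec, dotProduct, PiLp.inner_apply, mul_comm]
  rw [h1]
  exact abs_real_inner_le_norm _ _

theorem isWeakGradOn_coord {n : ℕ} {Ω : Set (En n)} (hΩ : IsOpen Ω) (i : Fin n) :
    IsWeakGradOn Ω (fun x => x i) (fun _ => EuclideanSpace.single i 1) := by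
  have hs : ContDiff ℝ (⊤ : ℕ∞) (fun x : En n => x i) :=
    (EuclideanSpace.proj i : En n →L[ℝ] ℝ).contDiff
  refine ⟨hs.continuous.continuousOn.locallyIntegrableOn hΩ.measurableSet,
    continuousOn_const.locallyIntegrableOn hΩ.measurableSet, fun ψ h1 h2 h3 j => ?_⟩
  rw [setIntegral_mul_eq_of_tsupport_subset _ ((tsupport_fderiv_apply_subset ℝ _).trans h3),
    setIntegral_mul_eq_of_tsupport_subset (fun _ => (EuclideanSpace.single i 1 : En n) j) h3,
    integral_mul_fderiv_eq_neg_of_contDiff hs h1 h2]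
  congr 1
  refine integral_congr_ae (Eventually.of_forall fun x => ?_)
  have h4 : fderiv ℝ (fun x : En n => x i) x = EuclideanSpace.proj i :=
    (EuclideanSpace.proj i : En n →L[ℝ] ℝ).fderiv
  simp only [h4]
  simp [eq_comm]

theorem lintegral_sum_rpow_ne_top {α ι : Type*} [MeasurableSpace α] [Fintype ι] {μ : Measure α}
    {q : ℝ} (hq : 1 ≤ q) {s : ι → α → ℝ≥0∞} (hs : ∀ i, AEMeasurable (s i) μ)
    (h : ∀ i, ∫⁻ x, s i x ^ q ∂μ ≠ ⊤) : ∫⁻ x, (∑ i, s i x) ^ q ∂μ ≠ ⊤ := by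
  have hle : ∀ x, (∑ i, s i x) ^ q ≤ (Fintype.card ι : ℝ≥0∞) ^ (q - 1) * ∑ i, s i x ^ q :=
    fun x => by
      simpa using ENNReal.rpow_sum_le_const_mul_sum_rpow Finset.univ (fun i => s i x) hq
  refine ne_top_of_le_ne_top ?_ (lintegral_mono hle)
  rw [lintegral_const_mul'' _ (Finset.aemeasurable_fun_sum _ fun i _ => (hs i).pow_const q),
    lintegral_finsetSum' _ fun i _ => (hs i).pow_const q]
  exact ENNReal.mul_ne_top (ENNReal.rpow_ne_top_of_nonneg (by linarith) (by simp))
    (ENNReal.sum_ne_top.2 fun i _ => h i)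

/-- A homeomorphism `φ : Ω → Ω̃` generates a bounded composition operator
`φ* : L¹_∞(Ω̃) → L¹_q(Ω,w)` iff `φ ∈ L¹_q(Ω,w;Ω̃)`. -/
theorem composition_operator_Linfty_iff_weighted_Sobolev
    (n : ℕ) (hn : 2 ≤ n) (Ω Ω' : Set (En n))
    (hΩ : IsDomainSet Ω) (hΩ' : IsDomainSet Ω')
    (q : ℝ) (hq : 1 < q) (w : En n → ℝ) (hw : IsWeight n w)
    (hAq : IsMuckenhoupt n q (fun x => w x ^ q))
    (φ : En n → En n) (hφ : ∃ ψ, IsHomeoOn Ω Ω' φ ψ) :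
    (∃ K : ℝ≥0∞, K ≠ ⊤ ∧
        ∀ f gf, ContinuousOn f Ω' → IsWeakGradOn Ω' f gf →
          essSup (fun x => ENNReal.ofReal ‖gf x‖) (volume.restrict Ω') ≠ ⊤ →
          ∃ g, IsWeakGradOn Ω (f ∘ φ) g ∧
            gradNormLp Ω w q g ≤
              K * essSup (fun x => ENNReal.ofReal ‖gf x‖) (volume.restrict Ω')) ↔
      (∃ Dφ, MapInL1q Ω w q φ Dφ) := by
  obtain ⟨_, hφc, _, hφm, _⟩ := hφ
  constructor
  · rintro ⟨K, hK, h⟩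
    have hes : ∀ i : Fin n, essSup (fun _ : En n => ENNReal.ofReal
        ‖(EuclideanSpace.single i 1 : En n)‖) (volume.restrict Ω') ≤ 1 := fun i =>
      essSup_le_of_ae_le _ (Eventually.of_forall fun x => by simp)
    have h' := fun i : Fin n => h (fun x => x i) (fun _ => EuclideanSpace.single i 1)
      (EuclideanSpace.proj (𝕜 := ℝ) i).continuous.continuousOn (isWeakGradOn_coord hΩ'.1 i)
      (ne_top_of_le_ne_top one_ne_top (hes i))
    choose g hg hgn using h'
    refine ⟨fun x => Matrix.of fun i j => g i x j, fun i => hg i, ?_⟩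
    have hfin : ∀ i, ∫⁻ x in Ω, ENNReal.ofReal (‖g i x‖ * w x) ^ q ≠ ⊤ := by
      intro i htop
      have := (hgn i).trans_lt (ENNReal.mul_lt_top hK.lt_top ((hes i).trans_lt one_lt_top))
      rw [gradNormLp, htop, ENNReal.top_rpow_of_pos (by positivity)] at this
      exact lt_irrefl _ this
    have hwm : AEMeasurable w (volume.restrict Ω) := hw.2.aestronglyMeasurable.aemeasurable.restrict
    refine ne_top_of_le_ne_top (lintegral_sum_rpow_ne_top hq.le (fun i =>
      ((hg i).2.1.aestronglyMeasurable.norm.aemeasurable.mul hwm).ennreal_ofReal) hfin)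
      (lintegral_mono fun x => ?_)
    refine ENNReal.rpow_le_rpow ?_ (by linarith)
    change _ ≤ ∑ i, ENNReal.ofReal (‖g i x‖ * w x)
    rw [← ENNReal.ofReal_sum_of_nonneg fun i _ => mul_nonneg (norm_nonneg _) (hw.1 x),
      ← Finset.sum_mul]
    exact ENNReal.ofReal_le_ofReal
      (mul_le_mul_of_nonneg_right (opNorm_le_sum_norm_row _) (hw.1 x))
  · rintro ⟨Dφ, hD, hfin⟩
    set I := ∫⁻ x in Ω, ENNReal.ofReal (opNorm (Dφ x) * w x) ^ q with hI
    have hq0 : 0 < q := by linarith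
    refine ⟨((n * n : ℕ) : ℝ≥0∞) * I ^ (1 / q), ENNReal.mul_ne_top (ENNReal.natCast_ne_top _)
      (ENNReal.rpow_ne_top_of_nonneg (by positivity) hfin), fun f gf hf hgf hes => ?_⟩
    set S := essSup (fun x => ENNReal.ofReal ‖gf x‖) (volume.restrict Ω') with hS
    have hM : ∀ᵐ y ∂(volume.restrict Ω'), ‖gf y‖ ≤ S.toReal := by
      filter_upwards [ENNReal.ae_le_essSup fun x => ENNReal.ofReal ‖gf x‖] with y hy
      exact (ENNReal.ofReal_le_iff_le_toReal hes).1 hy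
    have hM0 : 0 ≤ S.toReal := ENNReal.toReal_nonneg
    have ha : ∀ i j, LocallyIntegrableOn (fun x => Dφ x j i) Ω volume := fun i j =>
      fun x hx => (EuclideanSpace.proj i : En n →L[ℝ] ℝ).integrableAtFilter_comp ((hD j).2.1 x hx)
    have hH : ∀ i, LocallyIntegrableOn (fun x => S.toReal * ∑ j, |Dφ x j i|) Ω volume := by
      refine fun i => (locallyIntegrableOn_iff hΩ.1.isLocallyClosed).2 fun k hk hkc => ?_
      exact (integrable_finsetSum _ fun j _ =>
        ((ha i j).integrableOn_compact_subset hk hkc).abs).const_mul _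
    have hu : LocallyIntegrableOn (f ∘ φ) Ω volume :=
      (hf.comp hφc hφm).locallyIntegrableOn hΩ.1.measurableSet
    have hex := fun i => exists_weak_derivative_of_le_integral hΩ.1 hu (hH i)
      (fun x => mul_nonneg hM0 (Finset.sum_nonneg fun j _ => abs_nonneg _))
      (EuclideanSpace.single i 1) fun ψ h1 h2 h3 =>
        abs_integral_comp_le hΩ.1 hΩ'.1 hφc hφm (ha i)
          (fun j ψ h1 h2 h3 => (hD j).2.2 ψ h1 h2 h3 i) hf hgf hM0 hM h1 h2 h3
    choose h hhi hhb hhw using hex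
    refine ⟨fun x => WithLp.toLp 2 fun i => h i x, ⟨hu, ?_, fun ψ h1 h2 h3 i => hhw i ψ h1 h2 h3⟩, ?_⟩
    · exact (locallyIntegrableOn_iff hΩ.1.isLocallyClosed).2 fun k hk hkc =>
        Integrable.of_eval_piLp fun i => (hhi i).integrableOn_compact_subset hk hkc
    · have hb : ∀ᵐ x ∂(volume.restrict Ω), ENNReal.ofReal
          (‖(WithLp.toLp 2 fun i => h i x : En n)‖ * w x) ^ q ≤
          (((n * n : ℕ) : ℝ≥0∞) * S) ^ q * ENNReal.ofReal (opNorm (Dφ x) * w x) ^ q := by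
        filter_upwards [ae_all_iff.2 hhb] with x hx
        rw [← ENNReal.mul_rpow_of_nonneg _ _ hq0.le]
        refine ENNReal.rpow_le_rpow ?_ hq0.le
        have h1 : ‖(WithLp.toLp 2 fun i => h i x : En n)‖ ≤
            (n * n : ℕ) * S.toReal * opNorm (Dφ x) := by
          refine (norm_le_sum_abs _).trans ?_
          calc ∑ i, |h i x| ≤ ∑ i : Fin n, ∑ j : Fin n, S.toReal * opNorm (Dφ x) := by
                refine Finset.sum_le_sum fun i _ => (hx i).trans ?_
                rw [Finset.mul_sum]
                exact Finset.sum_le_sum fun j _ =>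
                  mul_le_mul_of_nonneg_left (abs_entry_le_opNorm _ _ _) hM0
            _ = (n * n : ℕ) * S.toReal * opNorm (Dφ x) := by
                simp
                ring
        rw [← ENNReal.ofReal_toReal hes, ← ENNReal.ofReal_natCast,
          ← ENNReal.ofReal_mul (by positivity), ← ENNReal.ofReal_mul (by positivity), ← mul_assoc]
        exact ENNReal.ofReal_le_ofReal (mul_le_mul_of_nonneg_right h1 (hw.1 x))
      have hC : (((n * n : ℕ) : ℝ≥0∞) * S) ^ q ≠ ⊤ :=
        ENNReal.rpow_ne_top_of_nonneg hq0.le (ENNReal.mul_ne_top (ENNReal.natCast_ne_top _) hes)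
      calc gradNormLp Ω w q _ ≤
          ((((n * n : ℕ) : ℝ≥0∞) * S) ^ q * I) ^ (1 / q) := by
            rw [hI, ← lintegral_const_mul' _ _ hC]
            exact ENNReal.rpow_le_rpow (lintegral_mono_ae hb) (by positivity)
        _ = ((n * n : ℕ) : ℝ≥0∞) * I ^ (1 / q) * S := by
            rw [ENNReal.mul_rpow_of_nonneg _ _ (by positivity), ← ENNReal.rpow_mul,
              mul_one_div_cancel hq0.ne', ENNReal.rpow_one]
            ring
end
end

section
/- Let a homeomorphism φ : Ω → Ω̃ between domains in ℝⁿ (n ≥ 2) generate a bounded composition operator φ* : L¹_p(Ω̃) → L¹_q(Ω,w), 1 < q < p < ∞, where w is a weight. For every open bounded subset Ã ⊆ Ω̃ define Φ(Ã) as the supremum, over all continuous functions f ∈ L¹_p(Ω̃) that are compactly supported in Ã and satisfy ‖f | L¹_p(Ã)‖ ≠ 0, of the quantity (‖f∘φ | L¹_q(Ω,w)‖ / ‖f | L¹_p(Ã)‖)^{pq/(p−q)}. Then Φ is a bounded, monotone, countably additive set function on the open bounded subsets of Ω̃: Φ(Ã₁) ≤ Φ(Ã₂) whenever Ã₁ ⊆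 Ã₂, Σᵢ Φ(Uᵢ) = Φ(⋃ᵢ Uᵢ) for every countable collection of mutually disjoint open bounded sets Uᵢ whose union is bounded and contained in Ω̃, and sup Φ < ∞. -/
open MeasureTheory Set Metric Filter ENNReal

noncomputable section

section SetFunction

open scoped ContDiff Topology Manifold

theorem LocallyIntegrableOn.integrable_mul_of_isCompact {n : ℕ} {Ω : Set (En n)} {h : En n → ℝ}
    (hh : LocallyIntegrableOn h Ω volume) {ρ : En n → ℝ} (hρ : Continuous ρ) {K : Set (En n)}
    (hK : IsCompact K) (hKΩ : K ⊆ Ω) (hsupp : ∀ x ∉ K, ρ x = 0) :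
    Integrable (fun x => h x * ρ x) volume := by
  have h1 : IntegrableOn h K volume := hh.integrableOn_compact_subset hKΩ hK
  have h2 : IntegrableOn (fun x => h x * ρ x) K volume :=
    h1.mul_continuousOn hρ.continuousOn hK
  rwa [integrableOn_iff_integrable_of_support_subset] at h2
  intro x hx
  by_contra hxK
  exact hx (by simp [hsupp x hxK])

theorem fderiv_apply_eq_zero_of_notMem_tsupport {n : ℕ} {ψ : En n → ℝ} {x : En n}
    (hx : x ∉ tsupport ψ) (v : En n) : fderiv ℝ ψ x v = 0 := by
  have : x ∉ tsupport (fderiv ℝ ψ) := fun h => hx (tsupport_fderiv_subset ℝ h)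
  rw [image_eq_zero_of_notMem_tsupport this]; rfl

theorem continuous_fderiv_apply_const {n : ℕ} {ψ : En n → ℝ} (hψ : ContDiff ℝ ∞ ψ) (v : En n) :
    Continuous fun x => fderiv ℝ ψ x v :=
  (hψ.continuous_fderiv (by simp)).clm_apply continuous_const

theorem locallyIntegrableOn_coord {n : ℕ} {Ω : Set (En n)} {g : En n → En n}
    (hg : LocallyIntegrableOn g Ω volume) (i : Fin n) :
    LocallyIntegrableOn (fun x => g x i) Ω volume :=
  (EuclideanSpace.proj (𝕜 := ℝ) i).locallyIntegrableOn_comp hg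

theorem IsWeakGradOn.linear_combination {n : ℕ} {Ω : Set (En n)} {f₁ f₂ : En n → ℝ}
    {g₁ g₂ : En n → En n} (h₁ : IsWeakGradOn Ω f₁ g₁) (h₂ : IsWeakGradOn Ω f₂ g₂) (a b : ℝ) :
    IsWeakGradOn Ω (fun x => a * f₁ x + b * f₂ x) (fun x => a • g₁ x + b • g₂ x) := by
  refine ⟨(h₁.1.smul a).add (h₂.1.smul b), (h₁.2.1.smul a).add (h₂.2.1.smul b), ?_⟩
  intro ψ hψ hψc hψΩ i
  have hI : ∀ h : En n → ℝ, LocallyIntegrableOn h Ω volume →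
      Integrable (fun x => h x * fderiv ℝ ψ x (EuclideanSpace.single i 1))
        (volume.restrict Ω) := fun h hh =>
    (LocallyIntegrableOn.integrable_mul_of_isCompact hh (continuous_fderiv_apply_const hψ _) hψc hψΩ
      fun x hx => fderiv_apply_eq_zero_of_notMem_tsupport hx _).restrict
  have hJ : ∀ g : En n → En n, LocallyIntegrableOn g Ω volume →
      Integrable (fun x => g x i * ψ x) (volume.restrict Ω) := fun g hg =>
    (LocallyIntegrableOn.integrable_mul_of_isCompact (locallyIntegrableOn_coord hg i) hψ.continuous hψc hψΩ
      fun x hx => image_eq_zero_of_notMem_tsupport hx).restrict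
  have e1 := h₁.2.2 ψ hψ hψc hψΩ i
  have e2 := h₂.2.2 ψ hψ hψc hψΩ i
  calc _ = ∫ x in Ω, (a * (f₁ x * fderiv ℝ ψ x (EuclideanSpace.single i 1))
          + b * (f₂ x * fderiv ℝ ψ x (EuclideanSpace.single i 1))) := by
        congr 1; ext x; ring
    _ = a * (-∫ x in Ω, g₁ x i * ψ x) + b * (-∫ x in Ω, g₂ x i * ψ x) := by
        rw [integral_add ((hI _ h₁.1).const_mul a) ((hI _ h₂.1).const_mul b),
          integral_const_mul, integral_const_mul, e1, e2]
    _ = -∫ x in Ω, (a * (g₁ x i * ψ x) + b * (g₂ x i * ψ x)) := by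
        rw [integral_add ((hJ _ h₁.2.1).const_mul a) ((hJ _ h₂.2.1).const_mul b),
          integral_const_mul, integral_const_mul]; ring
    _ = _ := by
        congr 2; ext x; simp; ring

theorem IsWeakGradOn.ae_eq_zero {n : ℕ} {Ω V : Set (En n)} {f : En n → ℝ} {g : En n → En n}
    (h : IsWeakGradOn Ω f g) (hV : IsOpen V) (hVΩ : V ⊆ Ω) (hf : ∀ x ∈ V, f x = 0) :
    ∀ᵐ x, x ∈ V → g x = 0 := by
  have key : ∀ i : Fin n, ∀ᵐ x, x ∈ V → g x i = 0 := by
    intro i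
    refine hV.ae_eq_zero_of_integral_contDiff_smul_eq_zero ((locallyIntegrableOn_coord h.2.1 i).mono_set hVΩ) ?_
    intro ψ hψ hψc hψV
    have e := h.2.2 ψ hψ hψc (hψV.trans hVΩ) i
    have e0 : ∀ x, f x * fderiv ℝ ψ x (EuclideanSpace.single i 1) = 0 := by
      intro x
      by_cases hx : x ∈ tsupport ψ
      · rw [hf x (hψV hx), zero_mul]
      · rw [fderiv_apply_eq_zero_of_notMem_tsupport hx, mul_zero]
    simp only [e0, integral_zero] at e
    rw [setIntegral_eq_integral_of_forall_compl_eq_zero] at e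
    · simp only [smul_eq_mul]
      simp_rw [mul_comm (ψ _)]
      linarith
    · intro x hx
      rw [image_eq_zero_of_notMem_tsupport fun h' => hx (hVΩ (hψV h')), mul_zero]
  filter_upwards [ae_all_iff.2 key] with x hx hxV
  ext i
  simpa using hx i hxV

theorem IsWeakGradOn.ae_unique {n : ℕ} {Ω : Set (En n)} (hΩ : IsOpen Ω) {f : En n → ℝ}
    {g₁ g₂ : En n → En n} (h₁ : IsWeakGradOn Ω f g₁) (h₂ : IsWeakGradOn Ω f g₂) :
    ∀ᵐ x, x ∈ Ω → g₁ x = g₂ x := by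
  have := (h₁.linear_combination h₂ 1 (-1)).ae_eq_zero hΩ subset_rfl (by intro x _; ring)
  filter_upwards [this] with x hx hxΩ
  have := hx hxΩ
  simpa [← sub_eq_add_neg, sub_eq_zero] using this

theorem exists_contDiff_one_nhds_of_isClosed {n : ℕ} {K A : Set (En n)} (hK : IsClosed K)
    (hA : IsOpen A) (hKA : K ⊆ A) :
    ∃ χ : En n → ℝ, ContDiff ℝ ∞ χ ∧ (∀ x ∈ K, χ =ᶠ[𝓝 x] fun _ => 1) ∧ ∀ x ∉ A, χ x = 0 := by
  obtain ⟨χ, h1, h0, -⟩ := exists_contMDiffMap_one_nhds_of_subset_interior (n := (⊤ : ℕ∞)) 𝓘(ℝ, En n) hK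
    (hKA.trans hA.interior_eq.symm.subset)
  exact ⟨χ, χ.contMDiff.contDiff, fun x hx => h1.filter_mono (nhds_le_nhdsSet hx), h0⟩

theorem tsupport_indicator_subset {n : ℕ} {A B : Set (En n)} (hB : IsOpen B)
    (hAB : Disjoint A B) {f : En n → ℝ} (hfs : tsupport f ⊆ A ∪ B) :
    tsupport (A.indicator f) ⊆ tsupport f ∩ A := by
  have h : tsupport (A.indicator f) ⊆ tsupport f ∩ Bᶜ := by
    refine closure_minimal ?_ ((isClosed_tsupport f).inter hB.isClosed_compl)
    intro x hx
    have hxA : x ∈ A := mem_of_indicator_ne_zero hx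
    refine ⟨subset_tsupport f ?_, hAB.notMem_of_mem_left hxA⟩
    rwa [Function.mem_support, indicator_of_mem hxA] at hx
  exact fun x hx => ⟨(h hx).1, (hfs (h hx).1).resolve_right (h hx).2⟩

theorem continuousOn_indicator_of_tsupport_subset {n : ℕ} {Ω A B : Set (En n)} (hA : IsOpen A)
    (hB : IsOpen B) (hAB : Disjoint A B) {f : En n → ℝ} (hfs : tsupport f ⊆ A ∪ B)
    (hf : ContinuousOn f Ω) : ContinuousOn (A.indicator f) Ω := by
  intro x hx
  by_cases hxA : x ∈ A
  · refine (hf x hx).congr_of_eventuallyEq ?_ (indicator_of_mem hxA f)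
    exact mem_nhdsWithin_of_mem_nhds (by
      filter_upwards [hA.mem_nhds hxA] with y hy using indicator_of_mem hy f)
  · have hxs : x ∉ tsupport (A.indicator f) :=
      fun h => hxA (tsupport_indicator_subset hB hAB hfs h).2
    have : A.indicator f =ᶠ[𝓝 x] 0 := notMem_tsupport_iff_eventuallyEq.1 hxs
    exact (continuousAt_const.congr this.symm).continuousWithinAt

theorem IsWeakGradOn.indicator {n : ℕ} {Ω A B : Set (En n)} (hΩ : IsOpen Ω) (hA : IsOpen A)
    (hB : IsOpen B) (hAB : Disjoint A B) {f : En n → ℝ} {g : En n → En n}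
    (hfs : tsupport f ⊆ A ∪ B) (h : IsWeakGradOn Ω f g) :
    IsWeakGradOn Ω (A.indicator f) (A.indicator g) := by
  refine ⟨fun x hx => (h.1 x hx).imp fun s hs => ⟨hs.1, hs.2.indicator hA.measurableSet⟩,
    fun x hx => (h.2.1 x hx).imp fun s hs => ⟨hs.1, hs.2.indicator hA.measurableSet⟩, ?_⟩
  intro ψ hψ hψc hψΩ i
  have hKA : tsupport f ∩ Bᶜ ⊆ A := fun x hx => (hfs hx.1).resolve_right hx.2
  obtain ⟨χ, hχ, hχ1, hχ0⟩ := exists_contDiff_one_nhds_of_isClosed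
    ((isClosed_tsupport f).inter hB.isClosed_compl) hA hKA
  have e := h.2.2 (fun x => χ x * ψ x) (hχ.mul hψ) (hψc.mul_left)
    ((tsupport_mul_subset_right (f := χ)).trans hψΩ) i
  have e1 : ∀ x, A.indicator f x * fderiv ℝ ψ x (EuclideanSpace.single i 1)
      = f x * fderiv ℝ (fun x => χ x * ψ x) x (EuclideanSpace.single i 1) := by
    intro x
    by_cases hx : x ∈ tsupport f
    · rcases hfs hx with hxA | hxB
      · have : (fun x => χ x * ψ x) =ᶠ[𝓝 x] ψ := by
          filter_upwards [hχ1 x ⟨hx, hAB.notMem_of_mem_left hxA⟩] with y hy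
          simp [hy]
        rw [this.fderiv_eq, indicator_of_mem hxA]
      · have : (fun x => χ x * ψ x) =ᶠ[𝓝 x] fun _ => 0 := by
          filter_upwards [hB.mem_nhds hxB] with y hy
          simp [hχ0 y (hAB.notMem_of_mem_right hy)]
        rw [this.fderiv_eq, indicator_of_notMem (hAB.notMem_of_mem_right hxB)]
        simp
    · have hfx : f x = 0 := image_eq_zero_of_notMem_tsupport hx
      simp [hfx]
  have e2 : ∀ᵐ x, x ∈ Ω → g x i * (χ x * ψ x) = A.indicator g x i * ψ x := by
    have hz := h.ae_eq_zero (hΩ.inter (isClosed_tsupport f).isOpen_compl) inter_subset_left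
      fun x hx => image_eq_zero_of_notMem_tsupport hx.2
    filter_upwards [hz] with x hgx hxΩ
    by_cases hx : x ∈ tsupport f
    · rcases hfs hx with hxA | hxB
      · rw [indicator_of_mem hxA, (hχ1 x ⟨hx, hAB.notMem_of_mem_left hxA⟩).self_of_nhds, one_mul]
      · have hxA := hAB.notMem_of_mem_right hxB
        simp [indicator_of_notMem hxA, hχ0 x hxA]
    · have hgx : g x = 0 := hgx ⟨hxΩ, hx⟩
      have hAx : A.indicator g x = 0 := by
        by_cases hxA : x ∈ A <;> simp [hxA, hgx]
      simp [hgx, hAx]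
  simp only [e1]
  rw [e, setIntegral_congr_ae hΩ.measurableSet e2]

/-- The integral of `|g|^p w^p` over `Ω`, whose `p`-th root is `gradNormLp Ω w p g`. -/
def gradEnergy {n : ℕ} (Ω : Set (En n)) (w : En n → ℝ) (p : ℝ) (g : En n → En n) : ℝ≥0∞ :=
  ∫⁻ x in Ω, ENNReal.ofReal (‖g x‖ * w x) ^ p

theorem gradNormLp_eq_gradEnergy_rpow {n : ℕ} (Ω : Set (En n)) (w : En n → ℝ) (p : ℝ)
    (g : En n → En n) : gradNormLp Ω w p g = gradEnergy Ω w p g ^ (1 / p) := rfl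

theorem gradEnergy_congr {n : ℕ} {Ω : Set (En n)} (hΩ : MeasurableSet Ω) {w : En n → ℝ} {p : ℝ}
    {g₁ g₂ : En n → En n} (h : ∀ᵐ x, x ∈ Ω → g₁ x = g₂ x) :
    gradEnergy Ω w p g₁ = gradEnergy Ω w p g₂ := by
  refine setLIntegral_congr_fun_ae hΩ ?_
  filter_upwards [h] with x hx hxΩ
  rw [hx hxΩ]

theorem gradEnergy_eq_zero {n : ℕ} {Ω : Set (En n)} (hΩ : MeasurableSet Ω) {w : En n → ℝ} {p : ℝ}
    (hp : 0 < p) {g : En n → En n} (h : ∀ᵐ x, x ∈ Ω → g x = 0) : gradEnergy Ω w p g = 0 := by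
  rw [gradEnergy_congr hΩ (g₂ := fun _ => 0) h]
  simp [gradEnergy, hp]

theorem gradEnergy_inter_add_diff {n : ℕ} (Ω : Set (En n)) {P : Set (En n)}
    (hP : MeasurableSet P) (w : En n → ℝ) (p : ℝ) (g : En n → En n) :
    gradEnergy (Ω ∩ P) w p g + gradEnergy (Ω \ P) w p g = gradEnergy Ω w p g :=
  lintegral_inter_add_sdiff _ _ hP

theorem gradEnergy_smul {n : ℕ} (Ω : Set (En n)) (w : En n → ℝ) {p : ℝ} (hp : 0 < p)
    {a : ℝ} (ha : 0 ≤ a) (g : En n → En n) :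
    gradEnergy Ω w p (fun x => a • g x) = ENNReal.ofReal a ^ p * gradEnergy Ω w p g := by
  unfold gradEnergy
  rw [← lintegral_const_mul' _ _ (ENNReal.rpow_ne_top_of_nonneg hp.le ENNReal.ofReal_ne_top)]
  congr 1; ext x
  rw [← ENNReal.mul_rpow_of_nonneg _ _ hp.le, ← ENNReal.ofReal_mul ha, norm_smul,
    Real.norm_of_nonneg ha, mul_assoc]

theorem gradEnergy_linear_combination {n : ℕ} {Ω P : Set (En n)} (hΩ : MeasurableSet Ω)
    (hP : MeasurableSet P) (w : En n → ℝ) {p : ℝ} (hp : 0 < p) {g₁ g₂ : En n → En n}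
    (h₁ : ∀ᵐ x, x ∈ Ω \ P → g₁ x = 0) (h₂ : ∀ᵐ x, x ∈ Ω ∩ P → g₂ x = 0)
    {a b : ℝ} (ha : 0 ≤ a) (hb : 0 ≤ b) :
    gradEnergy Ω w p (fun x => a • g₁ x + b • g₂ x) =
      ENNReal.ofReal a ^ p * gradEnergy Ω w p g₁ + ENNReal.ofReal b ^ p * gradEnergy Ω w p g₂ := by
  rw [← gradEnergy_smul Ω w hp ha, ← gradEnergy_smul Ω w hp hb,
    ← gradEnergy_inter_add_diff Ω hP, ← gradEnergy_inter_add_diff Ω hP w p (fun x => a • g₁ x),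
    ← gradEnergy_inter_add_diff Ω hP w p (fun x => b • g₂ x)]
  rw [gradEnergy_eq_zero (hΩ.diff hP) hp (g := fun x => a • g₁ x)
      (by filter_upwards [h₁] with x hx h; simp [hx h]),
    gradEnergy_eq_zero (hΩ.inter hP) hp (g := fun x => b • g₂ x)
      (by filter_upwards [h₂] with x hx h; simp [hx h]), add_zero, zero_add]
  congr 1
  · refine gradEnergy_congr (hΩ.inter hP) ?_
    filter_upwards [h₂] with x hx h
    simp [hx h]
  · refine gradEnergy_congr (hΩ.diff hP) ?_
    filter_upwards [h₁] with x hx h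
    simp [hx h]

theorem rpow_div_rpow_rpow_le_iff {p q : ℝ} (hq : 0 < q) (hqp : q < p) {e a M : ℝ≥0∞}
    (ha : a ≠ 0) (ha' : a ≠ ⊤) :
    (e ^ (1 / q) / a ^ (1 / p)) ^ (p * q / (p - q)) ≤ M ↔
      e ≤ M ^ ((p - q) / p) * a ^ (q / p) := by
  have hp : 0 < p := hq.trans hqp
  have hpq : 0 < p - q := sub_pos.2 hqp
  have h1 : ((e ^ (1 / q) / a ^ (1 / p)) ^ (p * q / (p - q))) ^ ((p - q) / p)
      = e / a ^ (q / p) := by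
    rw [← ENNReal.rpow_mul, show p * q / (p - q) * ((p - q) / p) = q by field_simp,
      ENNReal.div_rpow_of_nonneg _ _ hq.le, ← ENNReal.rpow_mul, ← ENNReal.rpow_mul,
      show 1 / q * q = 1 by field_simp, show 1 / p * q = q / p by ring, ENNReal.rpow_one]
  rw [← ENNReal.rpow_le_rpow_iff (z := (p - q) / p) (by positivity), h1,
    ENNReal.div_le_iff (by simp [ha, ha']) (ENNReal.rpow_ne_top_of_nonneg (by positivity) ha')]

theorem rpow_mul_rpow_add_le {p q : ℝ} (hq : 0 < q) (hqp : q < p) (M₁ M₂ a₁ a₂ : ℝ≥0∞) :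
    M₁ ^ ((p - q) / p) * a₁ ^ (q / p) + M₂ ^ ((p - q) / p) * a₂ ^ (q / p) ≤
      (M₁ + M₂) ^ ((p - q) / p) * (a₁ + a₂) ^ (q / p) := by
  have hp : 0 < p := hq.trans hqp
  have hpq : 0 < p - q := sub_pos.2 hqp
  have hconj : (p / (p - q)).HolderConjugate (p / q) := by
    rw [Real.holderConjugate_iff]
    refine ⟨by rw [lt_div_iff₀ hpq]; linarith, by field_simp; ring⟩
  have h := ENNReal.inner_le_Lp_mul_Lq Finset.univ
    ![M₁ ^ ((p - q) / p), M₂ ^ ((p - q) / p)] ![a₁ ^ (q / p), a₂ ^ (q / p)] hconj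
  simp only [Fin.sum_univ_two, Matrix.cons_val_zero, Matrix.cons_val_one, ← ENNReal.rpow_mul] at h
  rw [show (p - q) / p * (p / (p - q)) = 1 by field_simp,
    show q / p * (p / q) = 1 by field_simp] at h
  simpa only [ENNReal.rpow_one, one_div_div] using h

theorem exists_scaling {p q : ℝ} (hq : 0 < q) (hqp : q < p) {e a : ℝ≥0∞}
    (ha : a ≠ 0) (ha' : a ≠ ⊤)
    (ht : (e ^ (1 / q) / a ^ (1 / p)) ^ (p * q / (p - q)) ≠ ⊤) :
    ∃ c : ℝ, 0 ≤ c ∧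
      ENNReal.ofReal c ^ p * a = (e ^ (1 / q) / a ^ (1 / p)) ^ (p * q / (p - q)) ∧
      ENNReal.ofReal c ^ q * e = (e ^ (1 / q) / a ^ (1 / p)) ^ (p * q / (p - q)) := by
  have hp : 0 < p := hq.trans hqp
  have hpq : 0 < p - q := sub_pos.2 hqp
  set t := (e ^ (1 / q) / a ^ (1 / p)) ^ (p * q / (p - q)) with htdef
  have he : t ^ ((p - q) / p) * a ^ (q / p) = e := by
    rw [htdef, ← ENNReal.rpow_mul, show p * q / (p - q) * ((p - q) / p) = q by field_simp,
      ENNReal.div_rpow_of_nonneg _ _ hq.le, ← ENNReal.rpow_mul, ← ENNReal.rpow_mul,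
      show 1 / q * q = 1 by field_simp, show 1 / p * q = q / p by ring, ENNReal.rpow_one]
    exact ENNReal.div_mul_cancel (by simp [ha, ha'])
      (ENNReal.rpow_ne_top_of_nonneg (by positivity) ha')
  have hfin : (t / a) ^ (1 / p) ≠ ⊤ :=
    ENNReal.rpow_ne_top_of_nonneg (by positivity) (ENNReal.div_ne_top ht ha)
  refine ⟨((t / a) ^ (1 / p)).toReal, ENNReal.toReal_nonneg, ?_, ?_⟩
  · rw [ENNReal.ofReal_toReal hfin, ← ENNReal.rpow_mul, one_div_mul_cancel hp.ne',
      ENNReal.rpow_one, ENNReal.div_mul_cancel ha ha']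
  · rw [ENNReal.ofReal_toReal hfin, ← ENNReal.rpow_mul, show 1 / p * q = q / p by ring]
    rw [← he]
    rw [mul_comm (t ^ _), ← mul_assoc, ← ENNReal.mul_rpow_of_nonneg _ _ (by positivity),
      ENNReal.div_mul_cancel ha ha', ← ENNReal.rpow_add_of_nonneg _ _ (by positivity)
      (by positivity), ← add_div, add_sub_cancel, div_self hp.ne', ENNReal.rpow_one]

/-- `φ` generates a composition operator `L¹_p(Ω') → L¹_q(Ω,w)` bounded by `K < ∞`,
with `1 < q < p`, and `φ : Ω → Ω'` is continuous between open sets. -/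
structure IsBoundedComposition {n : ℕ} (Ω Ω' : Set (En n)) (φ : En n → En n) (p q : ℝ)
    (w : En n → ℝ) (K : ℝ≥0∞) : Prop where
  isOpen_source : IsOpen Ω
  isOpen_target : IsOpen Ω'
  continuousOn : ContinuousOn φ Ω
  exponent_pos : 0 < q
  exponent_lt : q < p
  bound_ne_top : K ≠ ⊤
  bound : CompOpBound Ω Ω' φ p (fun _ => 1) q w K

/-- `f`, with weak gradient `gf`, competes in the supremum defining the set function at `A`,
and `g` is a weak gradient of `f ∘ φ`. -/
structure IsCompetitor {n : ℕ} (Ω Ω' : Set (En n)) (φ : En n → En n) (p : ℝ) (A : Set (En n))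
    (f : En n → ℝ) (gf g : En n → En n) : Prop where
  continuousOn : ContinuousOn f Ω'
  weakGrad : IsWeakGradOn Ω' f gf
  norm_ne_top : gradNormLp Ω' (fun _ => 1) p gf ≠ ⊤
  hasCompactSupport : HasCompactSupport f
  tsupport_subset : tsupport f ⊆ A
  weakGrad_comp : IsWeakGradOn Ω (f ∘ φ) g

/-- The set function `Φ` of a composition operator. -/
def compositionSetFunction {n : ℕ} (Ω Ω' : Set (En n)) (φ : En n → En n) (p q : ℝ)
    (w : En n → ℝ) (A : Set (En n)) : ℝ≥0∞ :=
  sSup {t : ℝ≥0∞ | ∃ f gf g : _, IsCompetitor Ω Ω' φ p A f gf g ∧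
    gradNormLp A (fun _ => 1) p gf ≠ 0 ∧
    t = (gradNormLp Ω w q g / gradNormLp A (fun _ => 1) p gf) ^ (p * q / (p - q))}

namespace IsCompetitor

variable {n : ℕ} {Ω Ω' : Set (En n)} {φ : En n → En n} {p q : ℝ} {w : En n → ℝ} {K : ℝ≥0∞}
  {A B : Set (En n)} {f f₁ f₂ : En n → ℝ} {gf gf₁ gf₂ g g₁ g₂ : En n → En n}

theorem mono (h : IsCompetitor Ω Ω' φ p A f gf g) (hs : tsupport f ⊆ B) :
    IsCompetitor Ω Ω' φ p B f gf g :=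
  { h with tsupport_subset := hs }

theorem ae_grad_eq_zero (hΩ' : IsOpen Ω') (h : IsCompetitor Ω Ω' φ p A f gf g) :
    ∀ᵐ x, x ∈ Ω' \ tsupport f → gf x = 0 :=
  h.weakGrad.ae_eq_zero (hΩ'.sdiff (isClosed_tsupport f)) sdiff_subset
    fun _ hx => image_eq_zero_of_notMem_tsupport hx.2

theorem ae_grad_comp_eq_zero (hΩ : IsOpen Ω) (hφ : ContinuousOn φ Ω)
    (h : IsCompetitor Ω Ω' φ p A f gf g) :
    ∀ᵐ x, x ∈ Ω ∩ φ ⁻¹' (tsupport f)ᶜ → g x = 0 :=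
  h.weakGrad_comp.ae_eq_zero
    (hφ.isOpen_inter_preimage hΩ (isClosed_tsupport f).isOpen_compl) inter_subset_left
    fun _ hx => image_eq_zero_of_notMem_tsupport (f := f) hx.2

theorem gradEnergy_target (hp : 0 < p) (hΩ' : IsOpen Ω') (hA : IsOpen A) (hAΩ : A ⊆ Ω')
    (h : IsCompetitor Ω Ω' φ p A f gf g) :
    gradEnergy Ω' (fun _ => 1) p gf = gradEnergy A (fun _ => 1) p gf := by
  rw [← gradEnergy_inter_add_diff Ω' hA.measurableSet, inter_eq_self_of_subset_right hAΩ,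
    gradEnergy_eq_zero (hΩ'.measurableSet.diff hA.measurableSet) hp, add_zero]
  filter_upwards [h.ae_grad_eq_zero hΩ'] with x hx h'
  exact hx ⟨h'.1, fun hs => h'.2 (h.tsupport_subset hs)⟩

theorem gradEnergy_ne_top (hp : 0 < p) (h : IsCompetitor Ω Ω' φ p A f gf g) :
    gradEnergy Ω' (fun _ => 1) p gf ≠ ⊤ := by
  intro h'
  apply h.norm_ne_top
  rw [gradNormLp_eq_gradEnergy_rpow, h', ENNReal.top_rpow_of_pos (by positivity)]

theorem gradNormLp_comp_le (hφ : IsBoundedComposition Ω Ω' φ p q w K)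
    (h : IsCompetitor Ω Ω' φ p A f gf g) :
    gradNormLp Ω w q g ≤ K * gradNormLp Ω' (fun _ => 1) p gf := by
  obtain ⟨g', hg', hle⟩ := hφ.bound f gf h.continuousOn h.weakGrad h.norm_ne_top
  rwa [gradNormLp_eq_gradEnergy_rpow, gradEnergy_congr hφ.isOpen_source.measurableSet
    (h.weakGrad_comp.ae_unique hφ.isOpen_source hg'), ← gradNormLp_eq_gradEnergy_rpow]

theorem gradEnergy_linear_combination_target (hp : 0 < p) (hΩ' : IsOpen Ω') (hA : IsOpen A)
    (hAB : Disjoint A B) (h₁ : IsCompetitor Ω Ω' φ p A f₁ gf₁ g₁)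
    (h₂ : IsCompetitor Ω Ω' φ p B f₂ gf₂ g₂) {a b : ℝ} (ha : 0 ≤ a) (hb : 0 ≤ b) :
    gradEnergy Ω' (fun _ => 1) p (fun x => a • gf₁ x + b • gf₂ x) =
      ENNReal.ofReal a ^ p * gradEnergy Ω' (fun _ => 1) p gf₁ +
        ENNReal.ofReal b ^ p * gradEnergy Ω' (fun _ => 1) p gf₂ := by
  refine gradEnergy_linear_combination hΩ'.measurableSet hA.measurableSet _ hp ?_ ?_ ha hb
  · filter_upwards [h₁.ae_grad_eq_zero hΩ'] with x hx h
    exact hx ⟨h.1, fun hs => h.2 (h₁.tsupport_subset hs)⟩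
  · filter_upwards [h₂.ae_grad_eq_zero hΩ'] with x hx h
    exact hx ⟨h.1, fun hs => hAB.notMem_of_mem_left h.2 (h₂.tsupport_subset hs)⟩

theorem gradEnergy_linear_combination_source (hq : 0 < q) (hΩ : IsOpen Ω)
    (hφ : ContinuousOn φ Ω) (hA : IsOpen A)
    (hAB : Disjoint A B) (h₁ : IsCompetitor Ω Ω' φ p A f₁ gf₁ g₁)
    (h₂ : IsCompetitor Ω Ω' φ p B f₂ gf₂ g₂) {a b : ℝ} (ha : 0 ≤ a) (hb : 0 ≤ b) :
    gradEnergy Ω w q (fun x => a • g₁ x + b • g₂ x) =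
      ENNReal.ofReal a ^ q * gradEnergy Ω w q g₁ + ENNReal.ofReal b ^ q * gradEnergy Ω w q g₂ := by
  refine gradEnergy_linear_combination hΩ.measurableSet
    (hφ.isOpen_inter_preimage hΩ hA).measurableSet _ hq ?_ ?_ ha hb
  · filter_upwards [h₁.ae_grad_comp_eq_zero hΩ hφ] with x hx h
    exact hx ⟨h.1, fun hs => h.2 ⟨h.1, h₁.tsupport_subset hs⟩⟩
  · filter_upwards [h₂.ae_grad_comp_eq_zero hΩ hφ] with x hx h
    exact hx ⟨h.1, fun hs => hAB.notMem_of_mem_left h.2.2 (h₂.tsupport_subset hs)⟩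

theorem linear_combination (hp : 0 < p) (hΩ' : IsOpen Ω') (hA : IsOpen A) (hAB : Disjoint A B)
    (h₁ : IsCompetitor Ω Ω' φ p A f₁ gf₁ g₁) (h₂ : IsCompetitor Ω Ω' φ p B f₂ gf₂ g₂)
    {a b : ℝ} (ha : 0 ≤ a) (hb : 0 ≤ b) :
    IsCompetitor Ω Ω' φ p (A ∪ B) (fun x => a * f₁ x + b * f₂ x)
      (fun x => a • gf₁ x + b • gf₂ x) (fun x => a • g₁ x + b • g₂ x) where
  continuousOn := (h₁.continuousOn.const_smul a).add (h₂.continuousOn.const_smul b)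
  weakGrad := h₁.weakGrad.linear_combination h₂.weakGrad a b
  norm_ne_top := by
    rw [gradNormLp_eq_gradEnergy_rpow,
      gradEnergy_linear_combination_target hp hΩ' hA hAB h₁ h₂ ha hb]
    have := h₁.gradEnergy_ne_top hp
    have := h₂.gradEnergy_ne_top hp
    exact ENNReal.rpow_ne_top_of_nonneg (by positivity) (ENNReal.add_ne_top.2
      ⟨ENNReal.mul_ne_top (ENNReal.rpow_ne_top_of_nonneg hp.le ENNReal.ofReal_ne_top) ‹_›,
        ENNReal.mul_ne_top (ENNReal.rpow_ne_top_of_nonneg hp.le ENNReal.ofReal_ne_top) ‹_›⟩)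
  hasCompactSupport := h₁.hasCompactSupport.mul_left.add h₂.hasCompactSupport.mul_left
  tsupport_subset := (tsupport_add _ _).trans (union_subset_union
    (tsupport_mul_subset_right.trans h₁.tsupport_subset)
    (tsupport_mul_subset_right.trans h₂.tsupport_subset))
  weakGrad_comp := h₁.weakGrad_comp.linear_combination h₂.weakGrad_comp a b

theorem exists_indicator (hφ : IsBoundedComposition Ω Ω' φ p q w K) (hA : IsOpen A)
    (hB : IsOpen B) (hAB : Disjoint A B) (h : IsCompetitor Ω Ω' φ p (A ∪ B) f gf g) :
    ∃ g', IsCompetitor Ω Ω' φ p A (A.indicator f) (A.indicator gf) g' := by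
  have hp := hφ.exponent_pos.trans hφ.exponent_lt
  have hc := continuousOn_indicator_of_tsupport_subset hA hB hAB h.tsupport_subset h.continuousOn
  have hw := h.weakGrad.indicator hφ.isOpen_target hA hB hAB h.tsupport_subset
  have hfin : gradNormLp Ω' (fun _ => 1) p (A.indicator gf) ≠ ⊤ := by
    refine ne_top_of_le_ne_top h.norm_ne_top ?_
    refine ENNReal.rpow_le_rpow (lintegral_mono fun x => ?_) (by positivity)
    refine ENNReal.rpow_le_rpow (ENNReal.ofReal_le_ofReal ?_) hp.le
    simpa using norm_indicator_le_norm_self gf x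
  have hs := tsupport_indicator_subset hB hAB h.tsupport_subset
  obtain ⟨g', hg', -⟩ := hφ.bound _ _ hc hw hfin
  exact ⟨g', hc, hw, hfin, h.hasCompactSupport.of_isClosed_subset (isClosed_tsupport _)
    (hs.trans inter_subset_left), hs.trans inter_subset_right, hg'⟩

end IsCompetitor

namespace IsBoundedComposition

variable {n : ℕ} {Ω Ω' : Set (En n)} {φ : En n → En n} {p q : ℝ} {w : En n → ℝ} {K : ℝ≥0∞}
  {A B : Set (En n)}

theorem compositionSetFunction_le_iff (hφ : IsBoundedComposition Ω Ω' φ p q w K)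
    (hA : IsOpen A) (hAΩ : A ⊆ Ω') {M : ℝ≥0∞} :
    compositionSetFunction Ω Ω' φ p q w A ≤ M ↔ ∀ f gf g, IsCompetitor Ω Ω' φ p A f gf g →
      gradEnergy Ω w q g ≤
        M ^ ((p - q) / p) * gradEnergy Ω' (fun _ => 1) p gf ^ (q / p) := by
  have hq := hφ.exponent_pos
  have hp := hq.trans hφ.exponent_lt
  rw [compositionSetFunction, sSup_le_iff]
  constructor
  · intro h f gf g hf
    by_cases h0 : gradEnergy Ω' (fun _ => 1) p gf = 0
    · have hle := hf.gradNormLp_comp_le hφ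
      simp only [gradNormLp_eq_gradEnergy_rpow, h0] at hle
      rw [ENNReal.zero_rpow_of_pos (by positivity), mul_zero, nonpos_iff_eq_zero,
        ENNReal.rpow_eq_zero_iff_of_pos (by positivity)] at hle
      simp [hle]
    · rw [← rpow_div_rpow_rpow_le_iff hq hφ.exponent_lt h0 (hf.gradEnergy_ne_top hp)]
      refine h _ ⟨f, gf, g, hf, ?_, ?_⟩
      · rw [gradNormLp_eq_gradEnergy_rpow, ← hf.gradEnergy_target hp hφ.isOpen_target hA hAΩ]
        simp [h0, hf.gradEnergy_ne_top hp]
      · rw [gradNormLp_eq_gradEnergy_rpow, gradNormLp_eq_gradEnergy_rpow,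
          ← hf.gradEnergy_target hp hφ.isOpen_target hA hAΩ]
  · rintro h _ ⟨f, gf, g, hf, h0, rfl⟩
    rw [gradNormLp_eq_gradEnergy_rpow, ← hf.gradEnergy_target hp hφ.isOpen_target hA hAΩ] at h0
    rw [gradNormLp_eq_gradEnergy_rpow, gradNormLp_eq_gradEnergy_rpow,
      ← hf.gradEnergy_target hp hφ.isOpen_target hA hAΩ,
      rpow_div_rpow_rpow_le_iff hq hφ.exponent_lt ?_ (hf.gradEnergy_ne_top hp)]
    · exact h f gf g hf
    · intro h'
      rw [h', ENNReal.zero_rpow_of_pos (by positivity)] at h0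
      exact h0 rfl

theorem gradEnergy_comp_le (hφ : IsBoundedComposition Ω Ω' φ p q w K)
    (hA : IsOpen A) (hAΩ : A ⊆ Ω') {f : En n → ℝ} {gf g : En n → En n}
    (hf : IsCompetitor Ω Ω' φ p A f gf g) :
    gradEnergy Ω w q g ≤ compositionSetFunction Ω Ω' φ p q w A ^ ((p - q) / p) *
      gradEnergy Ω' (fun _ => 1) p gf ^ (q / p) :=
  (hφ.compositionSetFunction_le_iff hA hAΩ).1 le_rfl f gf g hf

theorem compositionSetFunction_mono (hφ : IsBoundedComposition Ω Ω' φ p q w K)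
    (hA : IsOpen A) (hB : IsOpen B) (hAB : A ⊆ B) (hBΩ : B ⊆ Ω') :
    compositionSetFunction Ω Ω' φ p q w A ≤ compositionSetFunction Ω Ω' φ p q w B :=
  (hφ.compositionSetFunction_le_iff hA (hAB.trans hBΩ)).2 fun _ _ _ hf =>
    hφ.gradEnergy_comp_le hB hBΩ (hf.mono (hf.tsupport_subset.trans hAB))

theorem compositionSetFunction_le (hφ : IsBoundedComposition Ω Ω' φ p q w K)
    (hA : IsOpen A) (hAΩ : A ⊆ Ω') :
    compositionSetFunction Ω Ω' φ p q w A ≤ K ^ (p * q / (p - q)) := by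
  have hq := hφ.exponent_pos
  have hp := hq.trans hφ.exponent_lt
  have hpq : 0 < p - q := sub_pos.2 hφ.exponent_lt
  refine (hφ.compositionSetFunction_le_iff hA hAΩ).2 fun f gf g hf => ?_
  have h := ENNReal.rpow_le_rpow (hf.gradNormLp_comp_le hφ) hq.le
  rw [gradNormLp_eq_gradEnergy_rpow, gradNormLp_eq_gradEnergy_rpow, ← ENNReal.rpow_mul,
    ENNReal.mul_rpow_of_nonneg _ _ hq.le, ← ENNReal.rpow_mul,
    one_div_mul_cancel hq.ne', ENNReal.rpow_one, show 1 / p * q = q / p by ring] at h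
  rwa [← ENNReal.rpow_mul, show p * q / (p - q) * ((p - q) / p) = q by field_simp]

theorem compositionSetFunction_ne_top (hφ : IsBoundedComposition Ω Ω' φ p q w K)
    (hA : IsOpen A) (hAΩ : A ⊆ Ω') : compositionSetFunction Ω Ω' φ p q w A ≠ ⊤ := by
  have hq := hφ.exponent_pos
  have hp := hq.trans hφ.exponent_lt
  have hpq : 0 < p - q := sub_pos.2 hφ.exponent_lt
  exact ne_top_of_le_ne_top (ENNReal.rpow_ne_top_of_nonneg (by positivity) hφ.bound_ne_top)
    (hφ.compositionSetFunction_le hA hAΩ)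

theorem compositionSetFunction_union_le (hφ : IsBoundedComposition Ω Ω' φ p q w K)
    (hA : IsOpen A) (hB : IsOpen B) (hAB : Disjoint A B) (hAΩ : A ⊆ Ω') (hBΩ : B ⊆ Ω') :
    compositionSetFunction Ω Ω' φ p q w (A ∪ B) ≤
      compositionSetFunction Ω Ω' φ p q w A + compositionSetFunction Ω Ω' φ p q w B := by
  have hq := hφ.exponent_pos
  have hp := hq.trans hφ.exponent_lt
  refine (hφ.compositionSetFunction_le_iff (hA.union hB) (union_subset hAΩ hBΩ)).2
    fun f gf g hf => ?_
  obtain ⟨g₁, h₁⟩ := hf.exists_indicator hφ hA hB hAB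
  obtain ⟨g₂, h₂⟩ := IsCompetitor.exists_indicator hφ hB hA hAB.symm
    (hf.mono (by rw [union_comm]; exact hf.tsupport_subset))
  have hlin := h₁.linear_combination hp hφ.isOpen_target hA hAB h₂ zero_le_one zero_le_one
  have hsum : (fun x => 1 * A.indicator f x + 1 * B.indicator f x) = f := by
    ext x
    rw [one_mul, one_mul]
    by_cases hx : x ∈ tsupport f
    · rcases hf.tsupport_subset hx with hx | hx
      · simp [hx, hAB.notMem_of_mem_left hx]
      · simp [hx, hAB.notMem_of_mem_right hx]
    · have hfx : f x = 0 := image_eq_zero_of_notMem_tsupport hx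
      rw [hfx, indicator_apply_eq_zero.2 fun _ => hfx, indicator_apply_eq_zero.2 fun _ => hfx,
        add_zero]
  rw [hsum] at hlin
  rw [gradEnergy_congr hφ.isOpen_source.measurableSet
      (hf.weakGrad_comp.ae_unique hφ.isOpen_source hlin.weakGrad_comp),
    gradEnergy_congr hφ.isOpen_target.measurableSet
      (hf.weakGrad.ae_unique hφ.isOpen_target hlin.weakGrad),
    h₁.gradEnergy_linear_combination_target hp hφ.isOpen_target hA hAB h₂
      zero_le_one zero_le_one,
    h₁.gradEnergy_linear_combination_source hq hφ.isOpen_source hφ.continuousOn hA hAB h₂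
      zero_le_one zero_le_one]
  simp only [ENNReal.ofReal_one, ENNReal.one_rpow, one_mul]
  exact (add_le_add (hφ.gradEnergy_comp_le hA hAΩ h₁) (hφ.gradEnergy_comp_le hB hBΩ h₂)).trans
    (rpow_mul_rpow_add_le hq hφ.exponent_lt _ _ _ _)

theorem add_le_compositionSetFunction_union (hφ : IsBoundedComposition Ω Ω' φ p q w K)
    (hA : IsOpen A) (hB : IsOpen B) (hAB : Disjoint A B) (hAΩ : A ⊆ Ω') (hBΩ : B ⊆ Ω') :
    compositionSetFunction Ω Ω' φ p q w A + compositionSetFunction Ω Ω' φ p q w B ≤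
      compositionSetFunction Ω Ω' φ p q w (A ∪ B) := by
  have hq := hφ.exponent_pos
  have hp := hq.trans hφ.exponent_lt
  have hpq : 0 < p - q := sub_pos.2 hφ.exponent_lt
  have hABΩ := union_subset hAΩ hBΩ
  have hmonoA := hφ.compositionSetFunction_mono hA (hA.union hB) subset_union_left hABΩ
  have hmonoB := hφ.compositionSetFunction_mono hB (hA.union hB) subset_union_right hABΩ
  rcases eq_or_ne (compositionSetFunction Ω Ω' φ p q w A) 0 with hA0 | hA0
  · rwa [hA0, zero_add]
  rcases eq_or_ne (compositionSetFunction Ω Ω' φ p q w B) 0 with hB0 | hB0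
  · rwa [hB0, add_zero]
  conv_lhs => rw [compositionSetFunction, compositionSetFunction, sSup_eq_iSup, sSup_eq_iSup]
  refine ENNReal.biSup_add_biSup_le ?_ ?_ ?_
  · by_contra h
    exact hA0 (by rw [compositionSetFunction, not_nonempty_iff_eq_empty.1 h]; simp)
  · by_contra h
    exact hB0 (by rw [compositionSetFunction, not_nonempty_iff_eq_empty.1 h]; simp)
  intro t₁ ht₁ t₂ ht₂
  have htop₁ : t₁ ≠ ⊤ :=
    ne_top_of_le_ne_top (hφ.compositionSetFunction_ne_top hA hAΩ) (le_sSup ht₁)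
  have htop₂ : t₂ ≠ ⊤ :=
    ne_top_of_le_ne_top (hφ.compositionSetFunction_ne_top hB hBΩ) (le_sSup ht₂)
  obtain ⟨f₁, gf₁, g₁, h₁, hn₁, rfl⟩ := ht₁
  obtain ⟨f₂, gf₂, g₂, h₂, hn₂, rfl⟩ := ht₂
  simp only [gradNormLp_eq_gradEnergy_rpow] at hn₁ hn₂ htop₁ htop₂ ⊢
  rw [← h₁.gradEnergy_target hp hφ.isOpen_target hA hAΩ] at hn₁ htop₁ ⊢
  rw [← h₂.gradEnergy_target hp hφ.isOpen_target hB hBΩ] at hn₂ htop₂ ⊢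
  rw [Ne, ENNReal.rpow_eq_zero_iff_of_pos (by positivity)] at hn₁ hn₂
  obtain ⟨a, ha, ha₁, ha₂⟩ :=
    exists_scaling hq hφ.exponent_lt hn₁ (h₁.gradEnergy_ne_top hp) htop₁
  obtain ⟨b, hb, hb₁, hb₂⟩ :=
    exists_scaling hq hφ.exponent_lt hn₂ (h₂.gradEnergy_ne_top hp) htop₂
  have h := hφ.gradEnergy_comp_le (hA.union hB) hABΩ
    (h₁.linear_combination hp hφ.isOpen_target hA hAB h₂ ha hb)
  rw [h₁.gradEnergy_linear_combination_target hp hφ.isOpen_target hA hAB h₂ ha hb,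
    h₁.gradEnergy_linear_combination_source hq hφ.isOpen_source hφ.continuousOn hA hAB h₂ ha hb,
    ha₁, ha₂, hb₁, hb₂] at h
  set T := (gradEnergy Ω w q g₁ ^ (1 / q) / gradEnergy Ω' (fun _ => 1) p gf₁ ^ (1 / p)) ^
      (p * q / (p - q)) +
    (gradEnergy Ω w q g₂ ^ (1 / q) / gradEnergy Ω' (fun _ => 1) p gf₂ ^ (1 / p)) ^
      (p * q / (p - q)) with hT
  rcases eq_or_ne T 0 with hT0 | hT0
  · rw [hT0]; exact zero_le
  have hTtop : T ≠ ⊤ := ENNReal.add_ne_top.2 ⟨htop₁, htop₂⟩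
  rw [← rpow_div_rpow_rpow_le_iff hq hφ.exponent_lt hT0 hTtop,
    ← ENNReal.rpow_sub _ _ hT0 hTtop, ← ENNReal.rpow_mul,
    show (1 / q - 1 / p) * (p * q / (p - q)) = 1 by field_simp, ENNReal.rpow_one] at h
  exact h

theorem compositionSetFunction_union (hφ : IsBoundedComposition Ω Ω' φ p q w K)
    (hA : IsOpen A) (hB : IsOpen B) (hAB : Disjoint A B) (hAΩ : A ⊆ Ω') (hBΩ : B ⊆ Ω') :
    compositionSetFunction Ω Ω' φ p q w (A ∪ B) =
      compositionSetFunction Ω Ω' φ p q w A + compositionSetFunction Ω Ω' φ p q w B :=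
  (hφ.compositionSetFunction_union_le hA hB hAB hAΩ hBΩ).antisymm
    (hφ.add_le_compositionSetFunction_union hA hB hAB hAΩ hBΩ)

theorem compositionSetFunction_empty (hφ : IsBoundedComposition Ω Ω' φ p q w K) :
    compositionSetFunction Ω Ω' φ p q w ∅ = 0 := by
  have hp := hφ.exponent_pos.trans hφ.exponent_lt
  rw [compositionSetFunction, ← nonpos_iff_eq_zero, sSup_le_iff]
  rintro _ ⟨f, gf, g, -, h, -⟩
  exact absurd (by simp [gradNormLp, hp]) h

theorem compositionSetFunction_biUnion (hφ : IsBoundedComposition Ω Ω' φ p q w K)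
    {U : ℕ → Set (En n)} (hU : ∀ i, IsOpen (U i)) (hd : Pairwise fun i j => Disjoint (U i) (U j))
    (hUΩ : ∀ i, U i ⊆ Ω') (s : Finset ℕ) :
    compositionSetFunction Ω Ω' φ p q w (⋃ i ∈ s, U i) =
      ∑ i ∈ s, compositionSetFunction Ω Ω' φ p q w (U i) := by
  induction s using Finset.induction_on with
  | empty => simp [hφ.compositionSetFunction_empty]
  | insert a s ha ih =>
    rw [Finset.set_biUnion_insert, Finset.sum_insert ha, ← ih]
    refine hφ.compositionSetFunction_union (hU a) (isOpen_biUnion fun i _ => hU i) ?_ (hUΩ a)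
      (iUnion₂_subset fun i _ => hUΩ i)
    exact disjoint_iUnion₂_right.2 fun i hi => hd fun h => ha (h ▸ hi)

theorem compositionSetFunction_iUnion (hφ : IsBoundedComposition Ω Ω' φ p q w K)
    {U : ℕ → Set (En n)} (hU : ∀ i, IsOpen (U i)) (hd : Pairwise fun i j => Disjoint (U i) (U j))
    (hUΩ : ∀ i, U i ⊆ Ω') :
    ∑' i, compositionSetFunction Ω Ω' φ p q w (U i) =
      compositionSetFunction Ω Ω' φ p q w (⋃ i, U i) := by
  have hq := hφ.exponent_pos
  have hp := hq.trans hφ.exponent_lt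
  have hpq : 0 < p - q := sub_pos.2 hφ.exponent_lt
  have hopen : IsOpen (⋃ i, U i) := isOpen_iUnion hU
  have hsub : (⋃ i, U i) ⊆ Ω' := iUnion_subset hUΩ
  apply le_antisymm
  · rw [ENNReal.tsum_eq_iSup_sum]
    refine iSup_le fun s => ?_
    rw [← hφ.compositionSetFunction_biUnion hU hd hUΩ s]
    exact hφ.compositionSetFunction_mono (isOpen_biUnion fun i _ => hU i) hopen
      (iUnion₂_subset fun i _ => subset_iUnion U i) hsub
  · refine (hφ.compositionSetFunction_le_iff hopen hsub).2 fun f gf g hf => ?_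
    obtain ⟨s, hs⟩ := hf.hasCompactSupport.isCompact.elim_finite_subcover U hU hf.tsupport_subset
    refine (hφ.gradEnergy_comp_le (A := ⋃ i ∈ s, U i) (isOpen_biUnion fun i _ => hU i)
      (iUnion₂_subset fun i _ => hUΩ i) (hf.mono hs)).trans ?_
    rw [hφ.compositionSetFunction_biUnion hU hd hUΩ s]
    gcongr
    exact ENNReal.sum_le_tsum s

end IsBoundedComposition

end SetFunction

/-- The set function associated with a bounded composition operator
`φ* : L¹_p(Ω̃) → L¹_q(Ω,w)`, `1 < q < p < ∞`, defined on open bounded `Ã ⊆ Ω̃` by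
`Φ(Ã) = sup (‖f∘φ | L¹_q(Ω,w)‖ / ‖f | L¹_p(Ã)‖)^{pq/(p−q)}` over continuous
`f ∈ L¹_p(Ω̃)` compactly supported in `Ã`, is bounded, monotone and countably additive. -/
theorem set_function_bounded_monotone_countably_additive
    (n : ℕ) (hn : 2 ≤ n) (Ω Ω' : Set (En n))
    (hΩ : IsDomainSet Ω) (hΩ' : IsDomainSet Ω')
    (p q : ℝ) (hq : 1 < q) (hqp : q < p)
    (w : En n → ℝ) (hw : IsWeight n w)
    (φ ψ : En n → En n) (hφ : IsHomeoOn Ω Ω' φ ψ)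
    (hbdd : BddCompOp Ω Ω' φ p (fun _ => 1) q w)
    (Φ : Set (En n) → ℝ≥0∞)
    (hΦ : ∀ A : Set (En n),
      Φ A = sSup {t : ℝ≥0∞ | ∃ f gf g : _,
        ContinuousOn f Ω' ∧ IsWeakGradOn Ω' f gf ∧
        gradNormLp Ω' (fun _ => 1) p gf ≠ ⊤ ∧
        HasCompactSupport f ∧ tsupport f ⊆ A ∧
        IsWeakGradOn Ω (f ∘ φ) g ∧
        gradNormLp A (fun _ => 1) p gf ≠ 0 ∧
        t = (gradNormLp Ω w q g / gradNormLp A (fun _ => 1) p gf) ^ (p * q / (p - q))}) :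
    (∀ A₁ A₂ : Set (En n), IsOpen A₁ → Bornology.IsBounded A₁ →
      IsOpen A₂ → Bornology.IsBounded A₂ → A₁ ⊆ A₂ → A₂ ⊆ Ω' → Φ A₁ ≤ Φ A₂) ∧
    (∀ U : ℕ → Set (En n), (∀ i, IsOpen (U i)) → (∀ i, Bornology.IsBounded (U i)) →
      (Pairwise fun i j => Disjoint (U i) (U j)) →
      (⋃ i, U i) ⊆ Ω' → Bornology.IsBounded (⋃ i, U i) →
      ∑' i, Φ (U i) = Φ (⋃ i, U i)) ∧
    (∃ M : ℝ≥0∞, M ≠ ⊤ ∧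
      ∀ A : Set (En n), IsOpen A → Bornology.IsBounded A → A ⊆ Ω' → Φ A ≤ M) := by
  obtain ⟨K, hK, hbound⟩ := hbdd
  have hcomp : IsBoundedComposition Ω Ω' φ p q w K :=
    ⟨hΩ.1, hΩ'.1, hφ.1, by linarith, hqp, hK, hbound⟩
  have hΦ' : ∀ A, Φ A = compositionSetFunction Ω Ω' φ p q w A := by
    intro A
    rw [hΦ A, compositionSetFunction]
    congr 1
    ext t
    constructor
    · rintro ⟨f, gf, g, h₁, h₂, h₃, h₄, h₅, h₆, h₇, h₈⟩
      exact ⟨f, gf, g, ⟨h₁, h₂, h₃, h₄, h₅, h₆⟩, h₇, h₈⟩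
    · rintro ⟨f, gf, g, ⟨h₁, h₂, h₃, h₄, h₅, h₆⟩, h₇, h₈⟩
      exact ⟨f, gf, g, h₁, h₂, h₃, h₄, h₅, h₆, h₇, h₈⟩
  simp only [hΦ']
  refine ⟨fun A₁ A₂ h₁ _ h₂ _ h₁₂ h₂Ω => hcomp.compositionSetFunction_mono h₁ h₂ h₁₂ h₂Ω,
    fun U hU _ hd hUΩ _ => hcomp.compositionSetFunction_iUnion hU hd
      fun i => (subset_iUnion U i).trans hUΩ,
    K ^ (p * q / (p - q)), ENNReal.rpow_ne_top_of_nonneg ?_ hK,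
    fun A hA _ hAΩ => hcomp.compositionSetFunction_le hA hAΩ⟩
  have := sub_pos.2 hqp
  have := hcomp.exponent_pos
  have := this.trans hqp
  positivity
end
end
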